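/- arXiv:math/0606196 — 4 statements merged into one kernel-verified Lean document; each statement's English description precedes it below -/
import Mathlib

section
/- Let σ be the K-algebra automorphism of P_n = K[x_1,…,x_n] (n ≥ 2) with σ(x_1) = x_1 − 1 and σ(x_i) = x_i + x_{i−1} for 2 ≤ i ≤ n. Then the subalgebra of σ-invariants P_n^σ = {p ∈ P_n : σ(p) = p} equals the K-subalgebra of P_n generated by the elements y_2, …, y_n, and moreover y_2, …, y_n are algebraically independent over K (so that P_n^σ is a polynomial algebra in n−1 variables). -/
noncomputable section

variable (K : Type*) [Field K] [CharZero K]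

/-- `xv K n k` is the variable `x_k` (1-based indexing) in `K[x_1,…,x_n]`
(junk value `0` when out of range). -/
def xv (n k : ℕ) : MvPolynomial (Fin n) K :=
  if h : k - 1 < n then MvPolynomial.X ⟨k - 1, h⟩ else 0

/-- `φ_{-i}(t) = t(t-1)⋯(t-i+1)/i!`, with `φ_0 = 1`. -/
def phiNeg (i : ℕ) : Polynomial K :=
  ((i.factorial : K)⁻¹) • ∏ j ∈ Finset.range i, (Polynomial.X - Polynomial.C (j : K))

/-- `y_{i+1} = Σ_{j=1}^{i} φ_{-(i-j)}(x_1)·x_{j+1} + i·φ_{-(i+1)}(x_1+1)`;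
`yv K n i` denotes `y_{i+1}`. -/
def yv (n i : ℕ) : MvPolynomial (Fin n) K :=
  (∑ j ∈ Finset.Icc 1 i, Polynomial.aeval (xv K n 1) (phiNeg K (i - j)) * xv K n (j + 1))
    + (i : MvPolynomial (Fin n) K) * Polynomial.aeval (xv K n 1 + 1) (phiNeg K (i + 1))

section PhiNeg

variable {K : Type*} [Field K] {A : Type*} [CommRing A] [Algebra K A]

theorem aeval_phiNeg_zero (t : A) : Polynomial.aeval t (phiNeg K 0) = 1 := by
  simp [phiNeg]

variable [CharZero K]

theorem factorial_mul_aeval_phiNeg (t : A) (k : ℕ) :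
    (k.factorial : A) * Polynomial.aeval t (phiNeg K k) = ∏ j ∈ Finset.range k, (t - (j : A)) := by
  have h : (k.factorial : A) = algebraMap K A (k.factorial : K) := by simp
  have h0 : (k.factorial : K) ≠ 0 := by exact_mod_cast k.factorial_ne_zero
  rw [phiNeg, map_smul, Algebra.smul_def, h, ← mul_assoc, ← map_mul, mul_inv_cancel₀ h0]
  simp [map_prod]

variable [IsDomain A] [CharZero A]

theorem succ_mul_aeval_phiNeg_succ (t : A) (k : ℕ) :
    ((k : A) + 1) * Polynomial.aeval t (phiNeg K (k + 1)) =
      (t - k) * Polynomial.aeval t (phiNeg K k) := by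
  have h0 : (k.factorial : A) ≠ 0 := by exact_mod_cast k.factorial_ne_zero
  have h1 := factorial_mul_aeval_phiNeg (K := K) t (k + 1)
  rw [Finset.prod_range_succ, ← factorial_mul_aeval_phiNeg (K := K), Nat.factorial_succ] at h1
  push_cast at h1
  apply mul_left_cancel₀ h0
  linear_combination h1

theorem succ_mul_aeval_add_one_phiNeg_succ (t : A) (k : ℕ) :
    ((k : A) + 1) * Polynomial.aeval (t + 1) (phiNeg K (k + 1)) =
      (t + 1) * Polynomial.aeval t (phiNeg K k) := by
  have h0 : (k.factorial : A) ≠ 0 := by exact_mod_cast k.factorial_ne_zero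
  have h1 := factorial_mul_aeval_phiNeg (K := K) (t + 1) (k + 1)
  have h2 : ∏ j ∈ Finset.range k, (t + 1 - ((j + 1 : ℕ) : A)) =
      ∏ j ∈ Finset.range k, (t - (j : A)) :=
    Finset.prod_congr rfl fun j _ => by push_cast; ring
  rw [Finset.prod_range_succ', h2, ← factorial_mul_aeval_phiNeg (K := K),
    Nat.factorial_succ] at h1
  push_cast at h1
  apply mul_left_cancel₀ h0
  linear_combination h1

/-- Pascal's rule for the polynomials `phiNeg`. -/
theorem aeval_add_one_phiNeg_succ (t : A) (k : ℕ) :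
    Polynomial.aeval (t + 1) (phiNeg K (k + 1)) =
      Polynomial.aeval t (phiNeg K (k + 1)) + Polynomial.aeval t (phiNeg K k) := by
  have h0 : (k : A) + 1 ≠ 0 := by exact_mod_cast k.succ_ne_zero
  apply mul_left_cancel₀ h0
  linear_combination succ_mul_aeval_add_one_phiNeg_succ (K := K) t k
    - succ_mul_aeval_phiNeg_succ (K := K) t k

end PhiNeg

section Invariants

variable {K : Type*} [Field K] {n : ℕ}

theorem yv_succ (m : ℕ) :
    yv K n (m + 1) = (∑ j ∈ Finset.range m,
        Polynomial.aeval (xv K n 1) (phiNeg K (m - j)) * xv K n (j + 2)) + xv K n (m + 2)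
      + ((m : MvPolynomial (Fin n) K) + 1) *
        Polynomial.aeval (xv K n 1 + 1) (phiNeg K (m + 2)) := by
  have h : Finset.Icc 1 (m + 1) = Finset.Ico 1 (m + 2) := by ext; simp; omega
  have h2 : ∀ j, m + 1 - (1 + j) = m - j := fun j => by omega
  have h3 : ∀ j, 1 + j + 1 = j + 2 := fun j => by omega
  rw [yv, h, Finset.sum_Ico_eq_sum_range, show m + 2 - 1 = m + 1 from rfl]
  simp only [h2, h3]
  rw [Finset.sum_range_succ, Nat.sub_self, aeval_phiNeg_zero, one_mul]
  push_cast
  rfl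

variable [CharZero K]

theorem map_yv_succ (σ : MvPolynomial (Fin n) K ≃ₐ[K] MvPolynomial (Fin n) K)
    (hσ1 : σ (xv K n 1) = xv K n 1 - 1)
    (hσ : ∀ k, 2 ≤ k → k ≤ n → σ (xv K n k) = xv K n k + xv K n (k - 1))
    (m : ℕ) (hm : m + 2 ≤ n) : σ (yv K n (m + 1)) = yv K n (m + 1) := by
  obtain ⟨t, ht⟩ : ∃ t, t + 1 = xv K n 1 := ⟨xv K n 1 - 1, by ring⟩
  have hphi : ∀ k, σ (Polynomial.aeval (xv K n 1) (phiNeg K k)) =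
      Polynomial.aeval t (phiNeg K k) := fun k => by
    rw [← Polynomial.aeval_algHom_apply σ, hσ1, ← ht, add_sub_cancel_right]
  have hphi' : ∀ k, σ (Polynomial.aeval (xv K n 1 + 1) (phiNeg K k)) =
      Polynomial.aeval (t + 1) (phiNeg K k) := fun k => by
    rw [← Polynomial.aeval_algHom_apply σ, map_add, hσ1, ← ht, map_one, add_sub_cancel_right]
  have hsum : ∑ j ∈ Finset.range m, Polynomial.aeval t (phiNeg K (m - j)) *
        (xv K n (j + 2) + xv K n (j + 1)) + xv K n (m + 1) =
      ∑ j ∈ Finset.range m, Polynomial.aeval (t + 1) (phiNeg K (m - j)) * xv K n (j + 2) +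
        Polynomial.aeval t (phiNeg K m) * xv K n 1 := by
    have h1 : ∑ j ∈ Finset.range m, Polynomial.aeval (t + 1) (phiNeg K (m - j)) * xv K n (j + 2) =
        ∑ j ∈ Finset.range m, (Polynomial.aeval t (phiNeg K (m - j)) * xv K n (j + 2) +
          Polynomial.aeval t (phiNeg K (m - (j + 1))) * xv K n (j + 1 + 1)) := by
      refine Finset.sum_congr rfl fun j hj => ?_
      obtain ⟨k, hk⟩ : ∃ k, m - j = k + 1 := ⟨m - j - 1, by
        have := Finset.mem_range.1 hj
        omega⟩
      have hk' : m - (j + 1) = k := by omega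
      rw [hk, hk', aeval_add_one_phiNeg_succ]
      ring
    have h2 := Finset.sum_range_succ'
      (fun j => Polynomial.aeval t (phiNeg K (m - j)) * xv K n (j + 1)) m
    rw [Finset.sum_range_succ, Nat.sub_self, aeval_phiNeg_zero, one_mul] at h2
    simp only [mul_add, Finset.sum_add_distrib] at h1 ⊢
    rw [h1]
    simp only [Nat.sub_zero, zero_add] at h2
    linear_combination h2
  rw [yv_succ]
  simp only [map_add, map_sum, map_mul, hphi, hphi', map_natCast, map_one]
  rw [hσ (m + 2) (by omega) hm, show m + 2 - 1 = m + 1 from rfl,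
    Finset.sum_congr rfl fun j hj => by
      rw [hσ (j + 2) (by omega) (by have := Finset.mem_range.1 hj; omega),
        show j + 2 - 1 = j + 1 from rfl],
    ← ht, aeval_add_one_phiNeg_succ (t + 1) (m + 1)]
  rw [← ht] at hsum
  have h := succ_mul_aeval_add_one_phiNeg_succ (K := K) t m
  linear_combination hsum - h

end Invariants

theorem Polynomial.eq_C_of_comp_X_sub_one_eq {R : Type*} [CommRing R] [IsDomain R] [CharZero R]
    {f : Polynomial R} (h : f.comp (Polynomial.X - 1) = f) : f = Polynomial.C (f.eval 0) := by
  have key : ∀ k : ℕ, f.eval (-(k : R)) = f.eval 0 := by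
    intro k
    induction k with
    | zero => simp
    | succ k ih =>
      rw [← ih]
      conv_rhs => rw [← h]
      rw [Polynomial.eval_comp]
      congr 1
      simp
      ring
  apply Polynomial.eq_of_infinite_eval_eq
  refine Set.infinite_of_injective_forall_mem (f := fun k : ℕ => -(k : R)) ?_ fun k => ?_
  · intro a b hab
    simpa using hab
  · simpa using key k

/-- A surjective ring endomorphism of a Noetherian ring is injective. -/
theorem RingHom.injective_of_surjective_of_isNoetherianRing {R : Type*} [CommRing R]
    [IsNoetherianRing R] (f : R →+* R) (hf : Function.Surjective f) : Function.Injective f := by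
  have hmono : Monotone fun k : ℕ => RingHom.ker (f ^ k) := by
    refine monotone_nat_of_le_succ fun k x hx => ?_
    rw [RingHom.mem_ker] at hx ⊢
    rw [pow_succ', RingHom.mul_def, RingHom.comp_apply, hx, map_zero]
  obtain ⟨k, hk⟩ := monotone_stabilizes_iff_noetherian.2 ‹_› ⟨_, hmono⟩
  rw [injective_iff_map_eq_zero]
  intro x hx
  obtain ⟨z, rfl⟩ : ∃ z, (f ^ k) z = x := by
    rw [RingHom.coe_pow]
    exact hf.iterate k x
  have hz : z ∈ RingHom.ker (f ^ (k + 1)) := by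
    rw [RingHom.mem_ker, pow_succ', RingHom.mul_def, RingHom.comp_apply, hx]
  have h : RingHom.ker (f ^ k) = RingHom.ker (f ^ (k + 1)) := hk (k + 1) k.le_succ
  rw [← h] at hz
  exact hz

/-- The substitution homomorphism sending the polynomial variable to `x_1` and the
coefficient variables to `y_2, …, y_{m+1}`. -/
def substXY (K : Type*) [Field K] (m : ℕ) :
    Polynomial (MvPolynomial (Fin m) K) →ₐ[K] MvPolynomial (Fin (m + 1)) K :=
  Polynomial.aevalTower (MvPolynomial.aeval fun i : Fin m => yv K (m + 1) ((i : ℕ) + 1))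
    (xv K (m + 1) 1)

section Subst

variable {K : Type*} [Field K] {m : ℕ}

theorem substXY_X : substXY K m Polynomial.X = xv K (m + 1) 1 :=
  Polynomial.aevalTower_X _ _

theorem substXY_C (c : MvPolynomial (Fin m) K) : substXY K m (Polynomial.C c) =
    MvPolynomial.aeval (fun i : Fin m => yv K (m + 1) ((i : ℕ) + 1)) c :=
  Polynomial.aevalTower_C _ _ _

theorem xv_mem_range_substXY (k : ℕ) (hk : k ≤ m) : xv K (m + 1) (k + 1) ∈ (substXY K m).range := by
  induction k using Nat.strong_induction_on with
  | _ k ih =>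
    obtain _ | k := k
    · exact ⟨_, substXY_X⟩
    have hy : yv K (m + 1) (k + 1) ∈ (substXY K m).range :=
      ⟨Polynomial.C (MvPolynomial.X ⟨k, hk⟩), by
        change substXY K m _ = _
        rw [substXY_C, MvPolynomial.aeval_X]⟩
    have hphi : ∀ (q : Polynomial K) (t : MvPolynomial (Fin (m + 1)) K),
        t ∈ (substXY K m).range → Polynomial.aeval t q ∈ (substXY K m).range := by
      rintro q _ ⟨t, rfl⟩
      exact ⟨Polynomial.aeval t q, (Polynomial.aeval_algHom_apply (substXY K m) t q).symm⟩
    have hx1 : xv K (m + 1) 1 ∈ (substXY K m).range := ⟨_, substXY_X⟩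
    have hx : xv K (m + 1) (k + 1 + 1) = yv K (m + 1) (k + 1) - ((∑ j ∈ Finset.range k,
          Polynomial.aeval (xv K (m + 1) 1) (phiNeg K (k - j)) * xv K (m + 1) (j + 2))
        + ((k : MvPolynomial (Fin (m + 1)) K) + 1) *
          Polynomial.aeval (xv K (m + 1) 1 + 1) (phiNeg K (k + 2))) := by
      rw [yv_succ]
      ring
    rw [hx]
    refine sub_mem hy (add_mem (sum_mem fun j hj => mul_mem (hphi _ _ hx1) ?_)
      (mul_mem (add_mem (natCast_mem _ _) (one_mem _)) (hphi _ _ (add_mem hx1 (one_mem _)))))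
    have := Finset.mem_range.1 hj
    exact ih (j + 1) (by omega) (by omega)

theorem substXY_surjective : Function.Surjective (substXY K m) := by
  rw [← AlgHom.range_eq_top, eq_top_iff, ← MvPolynomial.adjoin_range_X, Algebra.adjoin_le_iff]
  rintro _ ⟨i, rfl⟩
  have h := xv_mem_range_substXY (K := K) (i : ℕ) (Nat.le_of_lt_succ i.2)
  have hi : xv K (m + 1) ((i : ℕ) + 1) = MvPolynomial.X i := dif_pos i.2
  rwa [hi] at h

theorem substXY_injective : Function.Injective (substXY K m) := by
  have h : Function.Injective
      ((substXY K m).comp (MvPolynomial.finSuccEquiv K m).toAlgHom).toRingHom :=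
    RingHom.injective_of_surjective_of_isNoetherianRing _
      (substXY_surjective.comp (MvPolynomial.finSuccEquiv K m).surjective)
  intro a b hab
  apply (MvPolynomial.finSuccEquiv K m).symm.injective
  apply h
  simpa using hab

theorem map_substXY (σ : MvPolynomial (Fin (m + 1)) K ≃ₐ[K] MvPolynomial (Fin (m + 1)) K)
    (hσ1 : σ (xv K (m + 1) 1) = xv K (m + 1) 1 - 1)
    (hσy : ∀ i : Fin m, σ (yv K (m + 1) ((i : ℕ) + 1)) = yv K (m + 1) ((i : ℕ) + 1))
    (f : Polynomial (MvPolynomial (Fin m) K)) :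
    σ (substXY K m f) = substXY K m (f.comp (Polynomial.X - 1)) := by
  have hC : ∀ c, σ (substXY K m (Polynomial.C c)) = substXY K m (Polynomial.C c) := by
    have : (σ.toAlgHom.comp (MvPolynomial.aeval fun i : Fin m => yv K (m + 1) ((i : ℕ) + 1))) =
        MvPolynomial.aeval fun i : Fin m => yv K (m + 1) ((i : ℕ) + 1) := by
      ext i : 1
      simpa using hσy i
    intro c
    rw [substXY_C]
    exact DFunLike.congr_fun this c
  induction f using Polynomial.induction_on' with
  | add p q hp hq => simp only [map_add, hp, hq, Polynomial.add_comp]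
  | monomial k c =>
    rw [← Polynomial.C_mul_X_pow_eq_monomial]
    simp only [map_mul, map_pow, hC, substXY_X, hσ1, Polynomial.mul_comp, Polynomial.C_comp,
      Polynomial.pow_comp, Polynomial.X_comp, map_sub, map_one]

end Subst

/-- The algebra of invariants of `σ : x_1 ↦ x_1 - 1, x_i ↦ x_i + x_{i-1}` is the
polynomial algebra on `y_2, …, y_n`. -/
theorem fixed_algebra_eq_adjoin_y {K : Type*} [Field K] [CharZero K] {n : ℕ} (hn : 2 ≤ n)
    (σ : MvPolynomial (Fin n) K ≃ₐ[K] MvPolynomial (Fin n) K)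
    (hσ1 : σ (xv K n 1) = xv K n 1 - 1)
    (hσ : ∀ k, 2 ≤ k → k ≤ n → σ (xv K n k) = xv K n k + xv K n (k - 1)) :
    (∀ pp : MvPolynomial (Fin n) K,
        σ pp = pp ↔ pp ∈ Algebra.adjoin K (Set.range fun i : Fin (n - 1) => yv K n ((i : ℕ) + 1)))
    ∧ AlgebraicIndependent K (fun i : Fin (n - 1) => yv K n ((i : ℕ) + 1)) := by
  obtain ⟨m, rfl⟩ : ∃ m, n = m + 1 := ⟨n - 1, by omega⟩
  change (∀ p : MvPolynomial (Fin (m + 1)) K, σ p = p ↔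
      p ∈ Algebra.adjoin K (Set.range fun i : Fin m => yv K (m + 1) ((i : ℕ) + 1))) ∧
    AlgebraicIndependent K (fun i : Fin m => yv K (m + 1) ((i : ℕ) + 1))
  have hσy : ∀ i : Fin m, σ (yv K (m + 1) ((i : ℕ) + 1)) = yv K (m + 1) ((i : ℕ) + 1) :=
    fun i => map_yv_succ σ hσ1 hσ i (by omega)
  refine ⟨fun p => ?_, ?_⟩
  · rw [Algebra.adjoin_range_eq_range_aeval]
    obtain ⟨f, rfl⟩ := substXY_surjective p
    rw [map_substXY σ hσ1 hσy]
    constructor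
    · intro h
      rw [Polynomial.eq_C_of_comp_X_sub_one_eq (substXY_injective h), substXY_C]
      exact ⟨_, rfl⟩
    · rintro ⟨c, hc⟩
      have hf : f = Polynomial.C c := substXY_injective (by rw [substXY_C]; exact hc.symm)
      rw [hf, Polynomial.C_comp]
  · intro a b hab
    apply Polynomial.C_injective
    apply substXY_injective
    rw [substXY_C, substXY_C]
    exact hab
end
end

section
/- Let σ be the K-algebra automorphism of P_n = K[x_1,…,x_n] (n ≥ 2) with σ(x_1) = x_1 − 1 and σ(x_i) = x_i + x_{i−1} for 2 ≤ i ≤ n. Then the n elements x_1, y_2, …, y_n are algebraically independent over K and generate P_n as a K-algebra; that is, P_n = K[x_1, y_2, …, y_n] is a polynomial ring in these n elements (equivalently, P_n = K[x_1] ⊗_K P_n^σ). -/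
noncomputable section

variable (K : Type*) [Field K] [CharZero K]

theorem adjoin_range_x_y_eq_top {K : Type*} [Field K] [CharZero K] (n : ℕ) :
    Algebra.adjoin K
      (Set.range fun i : Fin n => if (i : ℕ) = 0 then xv K n 1 else yv K n (i : ℕ)) = ⊤ := by
  set A := Algebra.adjoin K
    (Set.range fun i : Fin n => if (i : ℕ) = 0 then xv K n 1 else yv K n (i : ℕ))
  have hgen (i : ℕ) (hi : i < n) : (if i = 0 then xv K n 1 else yv K n i) ∈ A :=
    Algebra.subset_adjoin ⟨⟨i, hi⟩, rfl⟩
  have hx (i : ℕ) (hi : i < n) : xv K n (i + 1) ∈ A := by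
    induction i using Nat.strong_induction_on with
    | _ i ih =>
      rcases Nat.eq_zero_or_pos i with rfl | hpos
      · simpa using hgen 0 hi
      have hx1 : xv K n 1 ∈ A := by simpa using hgen 0 (by omega)
      have hy : yv K n i ∈ A := by simpa [hpos.ne'] using hgen i hi
      have haeval {a : MvPolynomial (Fin n) K} (ha : a ∈ A) (p : Polynomial K) :
          Polynomial.aeval a p ∈ A := by
        simpa using (Polynomial.aeval (⟨a, ha⟩ : A) p).2
      obtain ⟨m, rfl⟩ : ∃ m, i = m + 1 := ⟨i - 1, by omega⟩
      rw [yv, Finset.sum_Icc_succ_top (by omega)] at hy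
      simp only [Nat.sub_self, show phiNeg K 0 = 1 by simp [phiNeg], map_one, one_mul] at hy
      have hsum : ∑ j ∈ Finset.Icc 1 m, Polynomial.aeval (xv K n 1) (phiNeg K (m + 1 - j)) *
          xv K n (j + 1) ∈ A := by
        refine sum_mem fun j hj => mul_mem (haeval hx1 _) (ih j ?_ ?_) <;>
          have := Finset.mem_Icc.mp hj <;> omega
      have htail := mul_mem (natCast_mem A (m + 1))
        (haeval (add_mem hx1 (one_mem A)) (phiNeg K (m + 1 + 1)))
      exact (add_mem_cancel_left hsum).mp ((add_mem_cancel_right htail).mp hy)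
  rw [eq_top_iff, ← MvPolynomial.adjoin_range_X, Algebra.adjoin_le_iff]
  rintro _ ⟨i, rfl⟩
  simpa [xv] using hx i i.2

/-- A family of generators of a polynomial ring over a domain, indexed by its finitely many
variables, is algebraically independent. -/
theorem MvPolynomial.algebraicIndependent_of_adjoin_range_eq_top {R ι : Type*} [CommRing R]
    [IsDomain R] [Finite ι] {f : ι → MvPolynomial ι R}
    (hf : Algebra.adjoin R (Set.range f) = ⊤) : AlgebraicIndependent R f := by
  have : Algebra.IsAlgebraic (Algebra.adjoin R (Set.range f)) (MvPolynomial ι R) :=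
    ⟨fun a => isAlgebraic_algebraMap
      (⟨a, hf ▸ Algebra.mem_top⟩ : Algebra.adjoin R (Set.range f))⟩
  refine (Algebra.IsAlgebraic.isTranscendenceBasis_of_lift_le_trdeg_of_finite R f ?_).1
  simp [MvPolynomial.trdeg_of_isDomain]

/-- `P_n = K[x_1, y_2, …, y_n]`: the elements `x_1, y_2, …, y_n` are algebraically
independent over `K` and generate `P_n` as a `K`-algebra. -/
theorem polynomial_ring_in_x1_and_y {K : Type*} [Field K] [CharZero K] {n : ℕ} (hn : 2 ≤ n)
    (σ : MvPolynomial (Fin n) K ≃ₐ[K] MvPolynomial (Fin n) K)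
    (hσ1 : σ (xv K n 1) = xv K n 1 - 1)
    (hσ : ∀ k, 2 ≤ k → k ≤ n → σ (xv K n k) = xv K n k + xv K n (k - 1)) :
    AlgebraicIndependent K (fun i : Fin n => if (i : ℕ) = 0 then xv K n 1 else yv K n (i : ℕ))
    ∧ Algebra.adjoin K
        (Set.range fun i : Fin n => if (i : ℕ) = 0 then xv K n 1 else yv K n (i : ℕ)) = ⊤ := by
  have h := adjoin_range_x_y_eq_top (K := K) n
  exact ⟨MvPolynomial.algebraicIndependent_of_adjoin_range_eq_top h, h⟩
end
end

section
/- Let σ be the K-algebra automorphism of P_n = K[x_1,…,x_n] (n ≥ 2) with σ(x_1) = x_1 − 1 and σ(x_i) = x_i + x_{i−1} for 2 ≤ i ≤ n, and set m = ⌊n/2⌋. Then the m+1 elements u_0 = 1 and u_k (k = 1,…,m) form a K-vector-space basis of the space of σ-invariant polynomials of total degree ≤ 2; in particular this space has dimension m+1 over K, and every σ-invariant polynomial of total degree ≤ 1 is a constant. -/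
noncomputable section

variable (K : Type*) [Field K] [CharZero K]

/-- The binomial coefficient `C(a,b)` for integers, with the convention that
`C(a,b) = 0` unless `0 ≤ b ≤ a`. -/
def ch (a b : ℤ) : ℤ := if 0 ≤ b ∧ b ≤ a then (a.toNat.choose b.toNat : ℤ) else 0

/-- `λ^k_{i,j} = (−1)^{k−i}(C(k−i, j−k) + C(k−i−1, j−k−1))`. -/
def lam (k i j : ℕ) : ℤ :=
  (-1) ^ (k - i) * (ch ((k : ℤ) - i) ((j : ℤ) - k) + ch ((k : ℤ) - i - 1) ((j : ℤ) - k - 1))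

/-- `μ^k_i = (−1)^{k−1}(C(k, i−k) + C(k−1, i−k−1))`. -/
def mu (k i : ℕ) : ℤ :=
  (-1) ^ (k - 1) * (ch (k : ℤ) ((i : ℤ) - k) + ch ((k : ℤ) - 1) ((i : ℤ) - k - 1))

/-- `α^k_{i,j} = (−1)^{k−i}(2C(k−i−1, j−k−1) + 3C(k−i−1, j−k−2)
  + (k−i−1)(C(k−i, j−k−1) + C(k−i−1, j−k−2)))`. -/
def alph (k i j : ℕ) : ℤ :=
  (-1) ^ (k - i) *
    (2 * ch ((k : ℤ) - i - 1) ((j : ℤ) - k - 1) + 3 * ch ((k : ℤ) - i - 1) ((j : ℤ) - k - 2)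
      + ((k : ℤ) - i - 1) *
        (ch ((k : ℤ) - i) ((j : ℤ) - k - 1) + ch ((k : ℤ) - i - 1) ((j : ℤ) - k - 2)))

/-- `β^k_j = α^k_{1,j−1} + α^k_{1,j} + μ^k_{j−1}`. -/
def bet (k j : ℕ) : ℤ := alph k 1 (j - 1) + alph k 1 j + mu k (j - 1)

/-- `u_k = x_k² + Σ_{i=1}^{k−1} Σ_{j=k}^{2k−i} λ^k_{i,j} x_i x_j + Σ_{i=k}^{2k} μ^k_i x_i`. -/
def u (n k : ℕ) : MvPolynomial (Fin n) K :=
  xv K n k ^ 2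
    + ∑ i ∈ Finset.Icc 1 (k - 1), ∑ j ∈ Finset.Icc k (2 * k - i),
        lam k i j • (xv K n i * xv K n j)
    + ∑ i ∈ Finset.Icc k (2 * k), mu k i • xv K n i

/-- For `k ≥ 2`:
`v_k = x_1·u_k + x_k x_{k+1} + Σ_{i=1}^{k−1} Σ_{j=k+1}^{2k−i+1} α^k_{i,j} x_i x_j
  + Σ_{i=k+1}^{2k+1} β^k_i x_i`. -/
def v (n k : ℕ) : MvPolynomial (Fin n) K :=
  xv K n 1 * u K n k + xv K n k * xv K n (k + 1)
    + ∑ i ∈ Finset.Icc 1 (k - 1), ∑ j ∈ Finset.Icc (k + 1) (2 * k - i + 1),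
        alph k i j • (xv K n i * xv K n j)
    + ∑ i ∈ Finset.Icc (k + 1) (2 * k + 1), bet k i • xv K n i

/-- `v_1 = x_1³ + 3x_1x_2 − x_1 + 3x_3`. -/
def v1 (n : ℕ) : MvPolynomial (Fin n) K :=
  xv K n 1 ^ 3 + 3 * xv K n 1 * xv K n 2 - xv K n 1 + 3 * xv K n 3

/-- The family `v_k`, `k ≥ 1`. -/
def vv (n k : ℕ) : MvPolynomial (Fin n) K := if k = 1 then v1 K n else v K n k

open Finset in
/-- The binomial sum `∑_b C(a,b) X_{l+b}`, i.e. `(1+E)^a` applied to `X` at `l`, for the shift `E`. -/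
def binomSum {R : Type*} [CommRing R] (X : ℕ → R) (a l : ℕ) : R :=
  ∑ b ∈ range (a + 1), (a.choose b : R) * X (l + b)

section Invariance

variable {R : Type*} [CommRing R] (X : ℕ → R)

lemma binomSum_zero (l : ℕ) : binomSum X 0 l = X l := by
  simp [binomSum]

lemma binomSum_succ (a l : ℕ) :
    binomSum X (a + 1) l = binomSum X a l + binomSum X a (l + 1) := by
  have h := Finset.sum_choose_succ_mul (R := R) (fun i _ => X (l + i)) a
  simp only [binomSum]
  rw [h]
  congr 1
  refine Finset.sum_congr rfl fun i _ => ?_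
  rw [show l + (i + 1) = l + 1 + i by ring]

lemma map_binomSum (σ : R →+* R) {N : ℕ}
    (hs : ∀ i, i + 1 ≤ N → σ (X (i + 1)) = X (i + 1) + X i) (a l : ℕ) (h : l + 1 + a ≤ N) :
    σ (binomSum X a (l + 1)) = binomSum X (a + 1) l := by
  rw [binomSum_succ, add_comm (binomSum X a l)]
  simp only [binomSum, map_sum, map_mul, map_natCast, ← Finset.sum_add_distrib, ← mul_add]
  refine Finset.sum_congr rfl fun b hb => ?_
  have hb' := Finset.mem_range.1 hb
  rw [show l + 1 + b = l + b + 1 by ring, hs _ (by omega)]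

/-- The quadratic form `X_k² + ∑_{i<k} ∑_j λ^k_{i,j} X_i X_j` for `k = j + 1`. -/
def quadForm (j : ℕ) : R :=
  X (j + 1) ^ 2 + ∑ i ∈ Finset.range (j + 1), X (j - i) *
    ((-1) ^ (i + 1) * (binomSum X i (j + 1) + 2 * binomSum X i (j + 2)))

lemma map_quadForm (σ : R →+* R) {N : ℕ} (h0 : σ (X 0) = X 0)
    (hs : ∀ i, i + 1 ≤ N → σ (X (i + 1)) = X (i + 1) + X i) (j : ℕ) (hj : 2 * (j + 1) ≤ N) :
    σ (quadForm X j) = quadForm X j := by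
  set B : ℕ → R := fun a => (-1) ^ (a + 1) * (binomSum X (a + 1) j + 2 * binomSum X (a + 1) (j + 1))
    with hB
  have hσB : ∀ a ∈ Finset.range (j + 1),
      σ (X (j - a) * ((-1) ^ (a + 1) * (binomSum X a (j + 1) + 2 * binomSum X a (j + 2)))) =
        X (j - a) * B a + (if a < j then X (j - a - 1) else 0) * B a := by
    intro a ha
    have ha' := Finset.mem_range.1 ha
    have hX : σ (X (j - a)) = X (j - a) + if a < j then X (j - a - 1) else 0 := by
      split_ifs with h
      · obtain ⟨t, ht⟩ : ∃ t, j - a = t + 1 := ⟨j - a - 1, by omega⟩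
        rw [ht, hs _ (by omega)]
        simp
      · rw [show j - a = 0 by omega, h0, add_zero]
    simp only [map_mul, map_add, map_pow, map_neg, map_one, map_ofNat, hX]
    rw [map_binomSum X σ hs _ _ (by omega), map_binomSum X σ hs _ _ (by omega)]
    ring
  have hstep : ∀ a, B (a + 1) + B a =
      (-1) ^ (a + 2) * (binomSum X (a + 1) (j + 1) + 2 * binomSum X (a + 1) (j + 2)) := by
    intro a
    simp only [hB, binomSum_succ X (a + 1)]
    ring
  have hB0 : B 0 = -(X j + 3 * X (j + 1) + 2 * X (j + 2)) := by
    simp only [hB, binomSum_succ, binomSum_zero]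
    ring
  have hsum : ∑ a ∈ Finset.range j, X (j - (a + 1)) * B (a + 1) +
      ∑ a ∈ Finset.range j, X (j - a - 1) * B a = ∑ a ∈ Finset.range j, X (j - (a + 1)) *
        ((-1) ^ (a + 2) * (binomSum X (a + 1) (j + 1) + 2 * binomSum X (a + 1) (j + 2))) := by
    rw [← Finset.sum_add_distrib]
    refine Finset.sum_congr rfl fun a _ => ?_
    rw [← hstep, Nat.sub_sub]
    ring
  have hP : ∑ a ∈ Finset.range (j + 1), (if a < j then X (j - a - 1) else 0) * B a =
      ∑ a ∈ Finset.range j, X (j - a - 1) * B a := by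
    rw [Finset.sum_range_succ]
    simp only [lt_irrefl, if_false, zero_mul, add_zero]
    exact Finset.sum_congr rfl fun a ha => by rw [if_pos (Finset.mem_range.1 ha)]
  rw [quadForm, map_add, map_sum, Finset.sum_congr rfl hσB, Finset.sum_add_distrib, hP,
    Finset.sum_range_succ', add_right_comm, hsum, Finset.sum_range_succ', map_pow,
    hs j (by omega), hB0]
  simp only [binomSum_zero, Nat.sub_zero]
  ring

end Invariance

section Recursion

variable {F : Type*} [Field F] [CharZero F]

lemma symm_recursion_eq_zero {n : ℕ} (c : ℕ → ℕ → F) (hsymm : ∀ i j, c i j = c j i)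
    (hsupp : ∀ i j, n < j → c i j = 0)
    (hrec : ∀ i j, c (i + 1) j + c i (j + 1) + c (i + 1) (j + 1) = 0)
    (hdiag : ∀ k, k ≤ n / 2 → c k k = 0) : ∀ i j, c i j = 0 := by
  have key : ∀ d i j, 2 * n + 1 ≤ i + j + d → c i j = 0 := by
    intro d
    induction d with
    | zero =>
      intro i j h
      by_cases hj : n < j
      · exact hsupp i j hj
      · rw [hsymm]
        exact hsupp j i (by omega)
    | succ d ih =>
      intro i j h
      rcases Nat.lt_or_ge (2 * n) (i + j + d) with h' | h'
      · exact ih i j (by omega)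
      have halt : ∀ s i j, i + j = s → 2 * n + 1 = s + (d + 1) → c i j = (-1) ^ i * c 0 s := by
        intro s i
        induction i with
        | zero => intro j hj _; simp [← hj]
        | succ i ihi =>
          intro j hj hs
          have h1 := hrec i j
          rw [ih (i + 1) (j + 1) (by omega), ihi (j + 1) (by omega) hs] at h1
          linear_combination h1
      have hz : c 0 (i + j) = 0 := by
        rcases Nat.lt_or_ge n (i + j) with hn | hn
        · exact hsupp _ _ hn
        rcases Nat.even_or_odd' (i + j) with ⟨k, hk | hk⟩
        · have h1 := halt (i + j) k k (by omega) (by omega)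
          rw [hdiag k (by omega)] at h1
          simpa using h1.symm
        · have h1 := halt (i + j) (i + j) 0 (by omega) (by omega)
          rw [hsymm, Odd.neg_one_pow ⟨k, hk⟩] at h1
          linear_combination (1 / 2 : F) * h1
      rw [halt (i + j) i j rfl (by omega), hz, mul_zero]
  exact fun i j => key (2 * n + 1) i j (by omega)

end Recursion

section Homogenization

/-- The variables `x_1, …, x_n` together with `x_0 = -1`. -/
def hvar (n i : ℕ) : MvPolynomial (Fin n) K := if i = 0 then -1 else xv K n i

/-- The exponent of the monomial `hvar K n i`. -/
def hexp (n i : ℕ) : Fin n →₀ ℕ :=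
  Finsupp.equivFunOnFinite.symm fun t => if (t : ℕ) + 1 = i then 1 else 0

/-- The sign of `hvar K n i`. -/
def hsign (i : ℕ) : K := if i = 0 then -1 else 1

lemma hexp_apply (n i : ℕ) (t : Fin n) : hexp n i t = if (t : ℕ) + 1 = i then 1 else 0 := rfl

omit [CharZero K] in
lemma hvar_eq_monomial {n i : ℕ} (hi : i ≤ n) :
    hvar K n i = MvPolynomial.monomial (hexp n i) (hsign K i) := by
  rcases Nat.eq_zero_or_pos i with rfl | h
  · have : hexp n 0 = 0 := by ext t; simp [hexp_apply]
    rw [this]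
    simp [hvar, hsign]
  · have : hexp n i = Finsupp.single ⟨i - 1, by omega⟩ 1 := by
      ext t
      rw [hexp_apply, Finsupp.single_apply]
      congr 1
      simp only [Fin.ext_iff, eq_iff_iff]
      omega
    rw [this]
    simp [hvar, hsign, h.ne', xv, show i - 1 < n by omega, MvPolynomial.X]

omit [CharZero K] in
lemma hsign_mul_self (i : ℕ) : hsign K i * hsign K i = 1 := by
  unfold hsign; split_ifs <;> simp

lemma hexp_add_eq_iff {n a b i j : ℕ} (ha : a ≤ n) (hb : b ≤ n) (hi : i ≤ n) (hj : j ≤ n) :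
    hexp n a + hexp n b = hexp n i + hexp n j ↔ (a = i ∧ b = j) ∨ (a = j ∧ b = i) := by
  constructor
  · intro h
    have key : ∀ t, 1 ≤ t → t ≤ n → ((if t = a then 1 else 0) + (if t = b then 1 else 0) : ℕ) =
        (if t = i then 1 else 0) + (if t = j then 1 else 0) := by
      intro t h1 h2
      have := DFunLike.congr_fun h (⟨t - 1, by omega⟩ : Fin n)
      simpa [hexp_apply, Nat.sub_add_cancel h1] using this
    have h1 := key a
    have h2 := key b
    have h3 := key i
    have h4 := key j
    grind
  · rintro (⟨rfl, rfl⟩ | ⟨rfl, rfl⟩)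
    · rfl
    · exact add_comm _ _

omit [CharZero K] in
lemma hvar_mul_hvar {n a b : ℕ} (ha : a ≤ n) (hb : b ≤ n) :
    hvar K n a * hvar K n b =
      MvPolynomial.monomial (hexp n a + hexp n b) (hsign K a * hsign K b) := by
  rw [hvar_eq_monomial K ha, hvar_eq_monomial K hb, MvPolynomial.monomial_mul]

omit [CharZero K] in
lemma coeff_hvar_mul_hvar {n a b i j : ℕ} (ha : a ≤ n) (hb : b ≤ n) (hi : i ≤ n) (hj : j ≤ n) :
    MvPolynomial.coeff (hexp n i + hexp n j) (hvar K n a * hvar K n b) =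
      if (a = i ∧ b = j) ∨ (a = j ∧ b = i) then hsign K i * hsign K j else 0 := by
  rw [hvar_mul_hvar K ha hb, MvPolynomial.coeff_monomial]
  simp only [hexp_add_eq_iff ha hb hi hj]
  split_ifs with h
  · rcases h with ⟨rfl, rfl⟩ | ⟨rfl, rfl⟩
    · rfl
    · exact mul_comm _ _
  · rfl

/-- The coefficient of `x_t²`, where the constant term is the coefficient of `x_0²`. -/
def diagCoeff (n t : ℕ) : MvPolynomial (Fin n) K →ₗ[K] K :=
  MvPolynomial.lcoeff K (hexp n t + hexp n t)

omit [CharZero K] in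
lemma diagCoeff_hvar_mul_hvar {n t a b : ℕ} (ht : t ≤ n) (ha : a ≤ n) (hb : b ≤ n) :
    diagCoeff K n t (hvar K n a * hvar K n b) = if a = t ∧ b = t then 1 else 0 := by
  simp [diagCoeff, MvPolynomial.lcoeff_apply, coeff_hvar_mul_hvar K ha hb ht ht,
    hsign_mul_self]

/-- The quadratic polynomial with coefficient matrix `c` in the homogenized variables. -/
def matPoly (n : ℕ) (c : ℕ → ℕ → K) : MvPolynomial (Fin n) K :=
  ∑ i ∈ Finset.range (n + 1), ∑ j ∈ Finset.range (n + 1), c i j • (hvar K n i * hvar K n j)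

lemma coeff_matPoly {n : ℕ} (c : ℕ → ℕ → K) {i j : ℕ} (hi : i ≤ n) (hj : j ≤ n) :
    MvPolynomial.coeff (hexp n i + hexp n j) (matPoly K n c) =
      hsign K i * hsign K j * (if i = j then c i i else c i j + c j i) := by
  have h : MvPolynomial.coeff (hexp n i + hexp n j) (matPoly K n c) =
      ∑ a ∈ Finset.range (n + 1), ∑ b ∈ Finset.range (n + 1), c a b *
        (if (a = i ∧ b = j) ∨ (a = j ∧ b = i) then hsign K i * hsign K j else 0) := by
    simp only [matPoly, MvPolynomial.coeff_sum, MvPolynomial.coeff_smul, smul_eq_mul]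
    refine Finset.sum_congr rfl fun a ha => Finset.sum_congr rfl fun b hb => ?_
    rw [coeff_hvar_mul_hvar K (by simpa [Nat.lt_succ_iff] using ha)
      (by simpa [Nat.lt_succ_iff] using hb) hi hj]
  rw [h]
  have hi' : i < n + 1 := by omega
  have hj' : j < n + 1 := by omega
  rcases eq_or_ne i j with rfl | hij
  · simp [ite_and, hi', mul_comm]
  · have hsplit : ∀ a b, c a b *
        (if (a = i ∧ b = j) ∨ (a = j ∧ b = i) then hsign K i * hsign K j else 0) =
        (if a = i then if b = j then c a b * (hsign K i * hsign K j) else 0 else 0) +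
        (if a = j then if b = i then c a b * (hsign K i * hsign K j) else 0 else 0) := by
      intro a b
      grind
    simp only [hsplit, Finset.sum_add_distrib]
    simp [Finset.sum_ite_irrel, hi', hj', hij]
    ring

lemma matPoly_eq_zero {n : ℕ} {c : ℕ → ℕ → K} (hsymm : ∀ i j, c i j = c j i)
    (h : matPoly K n c = 0) {i j : ℕ} (hi : i ≤ n) (hj : j ≤ n) : c i j = 0 := by
  have h1 := coeff_matPoly K c hi hj
  have hs : ∀ i, hsign K i ≠ 0 := fun i h0 => by simpa [h0] using hsign_mul_self K i
  rw [h, MvPolynomial.coeff_zero, eq_comm, mul_eq_zero] at h1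
  have h2 := h1.resolve_left (mul_ne_zero (hs i) (hs j))
  split_ifs at h2 with hij
  · rw [← hij]; exact h2
  · rw [hsymm j i] at h2
    linear_combination (1 / 2 : K) * h2

lemma diagCoeff_matPoly {n t : ℕ} (c : ℕ → ℕ → K) (ht : t ≤ n) :
    diagCoeff K n t (matPoly K n c) = c t t := by
  simp [diagCoeff, MvPolynomial.lcoeff_apply, coeff_matPoly K c ht ht, hsign_mul_self]

omit [CharZero K] in
lemma sum_smul_shift {M : Type*} [AddCommGroup M] [Module K M] {n : ℕ} (c : ℕ → K) (X Y : ℕ → M)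
    (hc : c (n + 1) = 0) (h0 : Y 0 = X 0) (hs : ∀ i, i + 1 ≤ n → Y (i + 1) = X (i + 1) + X i) :
    ∑ i ∈ Finset.range (n + 1), c i • Y i =
      ∑ i ∈ Finset.range (n + 1), (c i + c (i + 1)) • X i := by
  simp only [add_smul, Finset.sum_add_distrib]
  rw [Finset.sum_range_succ' (fun i => c i • Y i), Finset.sum_range_succ' (fun i => c i • X i),
    Finset.sum_range_succ (fun i => c (i + 1) • X i), hc, h0, zero_smul, add_zero,
    Finset.sum_congr rfl fun i hi => by rw [hs i (Finset.mem_range.1 hi), smul_add],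
    Finset.sum_add_distrib]
  abel

omit [CharZero K] in
lemma map_matPoly {n : ℕ} (σ : MvPolynomial (Fin n) K →ₐ[K] MvPolynomial (Fin n) K)
    (h0 : σ (hvar K n 0) = hvar K n 0)
    (hs : ∀ i, i + 1 ≤ n → σ (hvar K n (i + 1)) = hvar K n (i + 1) + hvar K n i)
    {c : ℕ → ℕ → K} (hsymm : ∀ i j, c i j = c j i) (hsupp : ∀ i j, n < j → c i j = 0) :
    σ (matPoly K n c) = matPoly K n fun i j =>
      c i j + c i (j + 1) + (c (i + 1) j + c (i + 1) (j + 1)) := by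
  have h1 : ∀ i, ∑ j ∈ Finset.range (n + 1), c i j • (σ (hvar K n i) * σ (hvar K n j)) =
      ∑ j ∈ Finset.range (n + 1), (c i j + c i (j + 1)) • (σ (hvar K n i) * hvar K n j) := fun i =>
    sum_smul_shift K (c i) (fun j => σ (hvar K n i) * hvar K n j) _ (hsupp _ _ (by omega))
      (by simp only [h0]) (fun j hj => by simp only [hs j hj, mul_add])
  have h2 : ∀ j, ∑ i ∈ Finset.range (n + 1),
        (c i j + c i (j + 1)) • (σ (hvar K n i) * hvar K n j) =
      ∑ i ∈ Finset.range (n + 1), (c i j + c i (j + 1) + (c (i + 1) j + c (i + 1) (j + 1))) •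
        (hvar K n i * hvar K n j) := fun j =>
    sum_smul_shift K (fun i => c i j + c i (j + 1)) (fun i => hvar K n i * hvar K n j) _
      (by rw [hsymm, hsymm _ (j + 1), hsupp _ _ (by omega), hsupp _ _ (by omega), add_zero])
      (by simp only [h0]) (fun j hj => by simp only [hs j hj, add_mul])
  simp only [matPoly, map_sum, map_smul, map_mul, h1]
  rw [Finset.sum_comm]
  simp only [h2]
  rw [Finset.sum_comm]

lemma exists_hexp_add_of_degree_le_two {n : ℕ} (m : Fin n →₀ ℕ) (hm : m.degree ≤ 2) :
    ∃ a ≤ n, ∃ b ≤ n, m = hexp n a + hexp n b := by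
  have hzero : hexp n 0 = 0 := by ext t; simp [hexp_apply]
  have hsingle : ∀ t : Fin n, hexp n (t + 1) = Finsupp.single t 1 := by
    intro t
    ext s
    rw [hexp_apply, Finsupp.single_apply]
    simp [Fin.ext_iff, eq_comm]
  have hone : ∀ m : Fin n →₀ ℕ, m ≠ 0 → ∃ (t : Fin n) (m' : Fin n →₀ ℕ),
      m = hexp n (t + 1) + m' ∧ m.degree = m'.degree + 1 := by
    intro m h
    obtain ⟨t, ht⟩ := Finsupp.ne_iff.1 h
    have hle : Finsupp.single t 1 ≤ m := by
      rw [Finsupp.single_le_iff]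
      exact Nat.one_le_iff_ne_zero.2 ht
    have hm : m = Finsupp.single t 1 + (m - Finsupp.single t 1) :=
      (add_tsub_cancel_of_le hle).symm
    refine ⟨t, m - Finsupp.single t 1, by rwa [hsingle], ?_⟩
    conv_lhs => rw [hm]
    rw [map_add, Finsupp.degree_single, add_comm]
  by_cases h : m = 0
  · exact ⟨0, by omega, 0, by omega, by simp [h, hzero]⟩
  obtain ⟨t, m', hm1, hd1⟩ := hone m h
  by_cases h' : m' = 0
  · exact ⟨t + 1, t.2, 0, by omega, by rw [hm1, h', hzero]⟩
  obtain ⟨t', m'', hm2, hd2⟩ := hone m' h'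
  have h0 : m'' = 0 := by
    rw [← Finsupp.degree_eq_zero_iff]
    omega
  exact ⟨t + 1, t.2, t' + 1, t'.2, by rw [hm1, hm2, h0, add_zero]⟩

lemma exists_matPoly_eq {n : ℕ} (p : MvPolynomial (Fin n) K) (hp : p.totalDegree ≤ 2) :
    ∃ c : ℕ → ℕ → K, (∀ i j, c i j = c j i) ∧ (∀ i j, n < j → c i j = 0) ∧
      matPoly K n c = p := by
  have hsum : ∀ s : Finset (Fin n →₀ ℕ), (∀ m ∈ s, m.degree ≤ 2) →
      ∃ c : ℕ → ℕ → K, (∀ i j, c i j = c j i) ∧ (∀ i j, n < j → c i j = 0) ∧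
      matPoly K n c = ∑ m ∈ s, MvPolynomial.monomial m (p.coeff m) := by
    intro s
    induction s using Finset.induction_on with
    | empty => exact fun _ => ⟨0, by simp, by simp, by simp [matPoly]⟩
    | insert m s hms ih =>
      intro hs
      obtain ⟨c, h1, h2, h3⟩ := ih fun m hm => hs m (Finset.mem_insert_of_mem hm)
      obtain ⟨a, ha, b, hb, rfl⟩ :=
        exists_hexp_add_of_degree_le_two m (hs m (Finset.mem_insert_self _ _))
      set r : K := p.coeff (hexp n a + hexp n b) * (hsign K a * hsign K b) / 2 with hr
      refine ⟨fun i j => (if i = a ∧ j = b then r else 0) + (if i = b ∧ j = a then r else 0) +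
        c i j, fun i j => ?_, fun i j hj => ?_, ?_⟩
      · have := h1 i j
        grind
      · simp [h2 i j hj, show ¬(i = a ∧ j = b) by omega, show ¬(i = b ∧ j = a) by omega]
      · have ha' : a < n + 1 := by omega
        have hb' : b < n + 1 := by omega
        have hss : hsign K a * hsign K b * (hsign K a * hsign K b) = 1 := by
          rw [mul_mul_mul_comm, hsign_mul_self, hsign_mul_self, one_mul]
        rw [Finset.sum_insert hms, ← h3]
        simp only [matPoly, add_smul, Finset.sum_add_distrib]
        congr 1
        simp only [ite_and, ite_smul, zero_smul, Finset.sum_ite_irrel, Finset.sum_ite_eq',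
          Finset.mem_range, ha', hb', if_true, Finset.sum_const_zero]
        rw [mul_comm (hvar K n b), ← add_smul, hvar_mul_hvar K ha hb, MvPolynomial.smul_monomial,
          hr]
        congr 1
        rw [smul_eq_mul]
        linear_combination p.coeff (hexp n a + hexp n b) * hss
  obtain ⟨c, h1, h2, h3⟩ := hsum p.support fun m hm =>
    (MvPolynomial.le_totalDegree hm).trans hp
  exact ⟨c, h1, h2, h3.trans p.as_sum.symm⟩

lemma invariant_eq_zero {n : ℕ} (σ : MvPolynomial (Fin n) K →ₐ[K] MvPolynomial (Fin n) K)
    (h0 : σ (hvar K n 0) = hvar K n 0)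
    (hs : ∀ i, i + 1 ≤ n → σ (hvar K n (i + 1)) = hvar K n (i + 1) + hvar K n i)
    (p : MvPolynomial (Fin n) K) (hp : p.totalDegree ≤ 2) (hσ : σ p = p)
    (hdiag : ∀ k ≤ n / 2, diagCoeff K n k p = 0) : p = 0 := by
  obtain ⟨c, hsymm, hsupp, rfl⟩ := exists_matPoly_eq K p hp
  have hrec : ∀ i j, c (i + 1) j + c i (j + 1) + c (i + 1) (j + 1) = 0 := by
    intro i j
    by_cases hi : n < i
    · rw [hsymm, hsymm i, hsymm (i + 1) (j + 1), hsupp _ _ (by omega), hsupp _ _ hi,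
        hsupp _ _ (by omega)]
      simp
    by_cases hj : n < j
    · rw [hsupp _ _ hj, hsupp _ _ (by omega), hsupp _ _ (by omega)]
      simp
    refine matPoly_eq_zero K (c := fun i j => c (i + 1) j + c i (j + 1) + c (i + 1) (j + 1))
      (fun i j => ?_) ?_ (not_lt.1 hi) (not_lt.1 hj)
    · simp only [hsymm i, hsymm (i + 1)]
      ring
    · rw [map_matPoly K σ h0 hs hsymm hsupp, ← sub_eq_zero] at hσ
      rw [← hσ]
      simp only [matPoly, ← Finset.sum_sub_distrib, ← sub_smul]
      refine Finset.sum_congr rfl fun i _ => Finset.sum_congr rfl fun j _ => ?_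
      congr 1
      ring
  have hc := symm_recursion_eq_zero c hsymm hsupp hrec fun k hk => by
    rw [← diagCoeff_matPoly K c (show k ≤ n by omega), hdiag k hk]
  simp [matPoly, hc]

end Homogenization

section Generators

lemma ch_natCast (a b : ℕ) : ch a b = a.choose b := by
  unfold ch
  split_ifs with h
  · simp
  · rw [Nat.choose_eq_zero_of_lt (by omega)]
    simp

lemma ch_of_neg {a b : ℤ} (h : b < 0) : ch a b = 0 := if_neg (by omega)

lemma sum_Icc_ch_smul {R : Type*} [CommRing R] (X : ℕ → R) (a k : ℕ) :
    ∑ l ∈ Finset.Icc k (k + (a + 1)),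
        (ch ((a + 1 : ℕ) : ℤ) ((l : ℤ) - k) + ch (a : ℤ) ((l : ℤ) - k - 1)) • X l =
      binomSum X a k + 2 * binomSum X a (k + 1) := by
  have h1 : Finset.Icc k (k + (a + 1)) = Finset.Ico k (k + (a + 2)) := by
    ext; simp; omega
  rw [h1, Finset.sum_Ico_eq_sum_range, Nat.add_sub_cancel_left]
  simp only [add_smul, Finset.sum_add_distrib, Nat.cast_add k, add_sub_cancel_left]
  have h2 : ∑ b ∈ Finset.range (a + 2), ch ((a + 1 : ℕ) : ℤ) b • X (k + b) =
      binomSum X (a + 1) k := by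
    simp only [binomSum, ch_natCast, zsmul_eq_mul, Int.cast_natCast]
  have h3 : ∑ b ∈ Finset.range (a + 2), ch (a : ℤ) ((b : ℤ) - 1) • X (k + b) =
      binomSum X a (k + 1) := by
    rw [Finset.sum_range_succ', ch_of_neg (by simp), zero_smul, add_zero, binomSum]
    refine Finset.sum_congr rfl fun b _ => ?_
    rw [Nat.cast_succ, add_sub_cancel_right, ch_natCast, show k + (b + 1) = k + 1 + b by ring]
    simp
  rw [h2, h3, binomSum_succ]
  ring

omit [CharZero K] in
lemma xv_eq_hvar {n i : ℕ} (hi : 1 ≤ i) : xv K n i = hvar K n i := by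
  rw [hvar, if_neg (by omega)]

omit [CharZero K] in
lemma sum_lam_smul (n : ℕ) {i : ℕ} (a : ℕ) (hi : 1 ≤ i) :
    ∑ l ∈ Finset.Icc (i + a + 1) (2 * (i + a + 1) - i),
        lam (i + a + 1) i l • (xv K n i * xv K n l) =
      hvar K n i * ((-1) ^ (a + 1) *
        (binomSum (hvar K n) a (i + a + 1) + 2 * binomSum (hvar K n) a (i + a + 2))) := by
  rw [← sum_Icc_ch_smul, Finset.mul_sum, Finset.mul_sum,
    show 2 * (i + a + 1) - i = i + a + 1 + (a + 1) by omega]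
  refine Finset.sum_congr rfl fun l hl => ?_
  have hl' := (Finset.mem_Icc.1 hl).1
  have h1 : ((i + a + 1 : ℕ) : ℤ) - i = ((a + 1 : ℕ) : ℤ) := by push_cast; ring
  have h2 : ((a + 1 : ℕ) : ℤ) - 1 = a := by push_cast; ring
  rw [xv_eq_hvar K hi, xv_eq_hvar K (show 1 ≤ l by omega), lam,
    show i + a + 1 - i = a + 1 by omega, h1, h2, zsmul_eq_mul, zsmul_eq_mul, Int.cast_mul,
    Int.cast_pow, Int.cast_neg, Int.cast_one]
  ring

omit [CharZero K] in
lemma sum_mu_smul (n j : ℕ) :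
    ∑ l ∈ Finset.Icc (j + 1) (2 * (j + 1)), mu (j + 1) l • xv K n l =
      hvar K n 0 * ((-1) ^ (j + 1) *
        (binomSum (hvar K n) j (j + 1) + 2 * binomSum (hvar K n) j (j + 2))) := by
  rw [← sum_Icc_ch_smul, Finset.mul_sum, Finset.mul_sum, two_mul]
  refine Finset.sum_congr rfl fun l hl => ?_
  have hl' := (Finset.mem_Icc.1 hl).1
  have h2 : ((j + 1 : ℕ) : ℤ) - 1 = j := by push_cast; ring
  rw [xv_eq_hvar K (show 1 ≤ l by omega), mu, h2, Nat.add_sub_cancel,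
    show hvar K n 0 = -1 from if_pos rfl, zsmul_eq_mul, zsmul_eq_mul, Int.cast_mul,
    Int.cast_pow, Int.cast_neg, Int.cast_one]
  ring

omit [CharZero K] in
lemma u_succ_eq_quadForm (n j : ℕ) : u K n (j + 1) = quadForm (hvar K n) j := by
  rw [u, sum_mu_smul, quadForm, xv_eq_hvar K (Nat.le_add_left 1 j), add_assoc]
  congr 1
  rw [← Finset.sum_range_reflect, Finset.sum_range_succ', Nat.add_sub_cancel]
  congr 1
  · rw [show Finset.Icc 1 j = Finset.Ico 1 (j + 1) by ext; simp,
      Finset.sum_Ico_eq_sum_range, Nat.add_sub_cancel]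
    refine Finset.sum_congr rfl fun i hi => ?_
    have hi' := Finset.mem_range.1 hi
    obtain ⟨a, rfl⟩ : ∃ a, j = i + 1 + a := ⟨j - (i + 1), by omega⟩
    rw [add_comm 1 i, sum_lam_smul K n a (Nat.le_add_left 1 i), Nat.add_sub_cancel_left,
      Nat.add_sub_cancel]
  · simp

omit [CharZero K] in
lemma diagCoeff_hvar_mul_binomSum {n t i a l : ℕ} (ht : t ≤ n) (hl : l + a ≤ n) (hi : i < l) :
    diagCoeff K n t (hvar K n i * binomSum (hvar K n) a l) = 0 := by
  rw [binomSum, Finset.mul_sum, map_sum]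
  refine Finset.sum_eq_zero fun b hb => ?_
  have hb' := Finset.mem_range.1 hb
  rw [mul_left_comm, ← nsmul_eq_mul, map_nsmul,
    diagCoeff_hvar_mul_hvar K ht (by omega) (by omega), if_neg (by omega), smul_zero]

omit [CharZero K] in
lemma diagCoeff_quadForm {n t j : ℕ} (ht : t ≤ n) (hj : 2 * (j + 1) ≤ n) :
    diagCoeff K n t (quadForm (hvar K n) j) = if t = j + 1 then 1 else 0 := by
  rw [quadForm, map_add, pow_two, diagCoeff_hvar_mul_hvar K ht (by omega) (by omega), map_sum,
    Finset.sum_eq_zero, add_zero]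
  · simp [eq_comm]
  intro i hi
  have hi' := Finset.mem_range.1 hi
  have h1 := diagCoeff_hvar_mul_binomSum K ht (show j + 1 + i ≤ n by omega)
    (show j - i < j + 1 by omega)
  have h2 := diagCoeff_hvar_mul_binomSum K ht (show j + 2 + i ≤ n by omega)
    (show j - i < j + 2 by omega)
  have h3 : hvar K n (j - i) * ((-1) ^ (i + 1) *
      (binomSum (hvar K n) i (j + 1) + 2 * binomSum (hvar K n) i (j + 2))) =
      ((-1) ^ (i + 1) : K) • (hvar K n (j - i) * binomSum (hvar K n) i (j + 1) +
        (2 : K) • (hvar K n (j - i) * binomSum (hvar K n) i (j + 2))) := by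
    simp only [Algebra.smul_def, map_pow, map_neg, map_one, map_ofNat]
    ring
  rw [h3, map_smul, map_add, map_smul, h1, h2]
  simp

omit [CharZero K] in
lemma totalDegree_u_le (n k : ℕ) : (u K n k).totalDegree ≤ 2 := by
  have hx : ∀ i, (xv K n i).totalDegree ≤ 1 := by
    intro i
    unfold xv
    split_ifs <;> simp
  have hxx : ∀ i j, (xv K n i * xv K n j).totalDegree ≤ 2 := fun i j =>
    (MvPolynomial.totalDegree_mul _ _).trans (add_le_add (hx i) (hx j))
  simp only [← MvPolynomial.mem_restrictTotalDegree] at hxx ⊢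
  have hx2 : ∀ i, xv K n i ∈ MvPolynomial.restrictTotalDegree (Fin n) K 2 := fun i =>
    (MvPolynomial.mem_restrictTotalDegree _ _ _).2 ((hx i).trans one_le_two)
  refine add_mem (add_mem (pow_two (xv K n k) ▸ hxx k k) ?_) ?_
  · exact sum_mem fun i _ => sum_mem fun j _ => zsmul_mem (hxx i j) _
  · exact sum_mem fun i _ => zsmul_mem (hx2 i) _

end Generators

/-- The elements `u_0 = 1, u_1, …, u_m` (`m = ⌊n/2⌋`) form a `K`-basis of the space of
`σ`-invariant polynomials of total degree ≤ 2; every `σ`-invariant polynomial of total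
degree ≤ 1 is a constant. -/
theorem quadratic_invariants_basis {K : Type*} [Field K] [CharZero K] {n : ℕ} (hn : 2 ≤ n)
    (σ : MvPolynomial (Fin n) K ≃ₐ[K] MvPolynomial (Fin n) K)
    (hσ1 : σ (xv K n 1) = xv K n 1 - 1)
    (hσ : ∀ k, 2 ≤ k → k ≤ n → σ (xv K n k) = xv K n k + xv K n (k - 1)) :
    LinearIndependent K
        (fun k : Fin (n / 2 + 1) => if (k : ℕ) = 0 then 1 else u K n (k : ℕ))
    ∧ (Submodule.span K
          (Set.range fun k : Fin (n / 2 + 1) => if (k : ℕ) = 0 then 1 else u K n (k : ℕ)) :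
          Set (MvPolynomial (Fin n) K))
        = {pp : MvPolynomial (Fin n) K | σ pp = pp ∧ pp.totalDegree ≤ 2}
    ∧ (∀ pp : MvPolynomial (Fin n) K, σ pp = pp → pp.totalDegree ≤ 1 →
        ∃ c : K, pp = MvPolynomial.C c) := by
  obtain ⟨τ, hτ⟩ : ∃ τ : MvPolynomial (Fin n) K →ₐ[K] MvPolynomial (Fin n) K, ∀ p, τ p = σ p :=
    ⟨σ.toAlgHom, fun _ => rfl⟩
  have h0 : τ (hvar K n 0) = hvar K n 0 := by simp [hvar]
  have hs : ∀ i, i + 1 ≤ n → τ (hvar K n (i + 1)) = hvar K n (i + 1) + hvar K n i := by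
    intro i hi
    rcases Nat.eq_zero_or_pos i with rfl | h
    · simpa [hvar, hτ, sub_eq_add_neg] using hσ1
    · simpa [hvar, hτ, h.ne'] using hσ (i + 1) (by omega) hi
  set f : Fin (n / 2 + 1) → MvPolynomial (Fin n) K :=
    fun k => if (k : ℕ) = 0 then 1 else u K n (k : ℕ) with hf
  have hfdiag : ∀ (t : ℕ) (k : Fin (n / 2 + 1)), t ≤ n →
      diagCoeff K n t (f k) = if t = k then 1 else 0 := by
    rintro t ⟨k, hk⟩ ht
    rcases k with _ | j
    · have h := diagCoeff_hvar_mul_hvar K ht (Nat.zero_le n) (Nat.zero_le n)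
      have h1 : hvar K n 0 * hvar K n 0 = 1 := by simp [hvar]
      rw [h1] at h
      simpa [hf, eq_comm] using h
    · simpa [hf, u_succ_eq_quadForm] using diagCoeff_quadForm K ht (show 2 * (j + 1) ≤ n by omega)
  have hfinv : ∀ k, τ (f k) = f k := by
    rintro ⟨k, hk⟩
    rcases k with _ | j
    · simp [hf]
    · simpa [hf, u_succ_eq_quadForm] using
        map_quadForm (hvar K n) (τ : MvPolynomial (Fin n) K →+* MvPolynomial (Fin n) K) h0 hs j
          (show 2 * (j + 1) ≤ n by omega)
  have hfdeg : ∀ k, (f k).totalDegree ≤ 2 := by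
    intro k
    simp only [hf]
    split_ifs
    · simp
    · exact totalDegree_u_le K n k
  have hexpand : ∀ p, τ p = p → p.totalDegree ≤ 2 →
      p = ∑ k : Fin (n / 2 + 1), diagCoeff K n k p • f k := by
    intro p hp hd
    rw [← sub_eq_zero]
    refine invariant_eq_zero K τ h0 hs _ ?_ ?_ ?_
    · rw [← MvPolynomial.mem_restrictTotalDegree] at hd ⊢
      exact sub_mem hd (sum_mem fun k _ => Submodule.smul_mem _ _
        ((MvPolynomial.mem_restrictTotalDegree _ _ _).2 (hfdeg k)))
    · simp only [map_sub, map_sum, map_smul, hp, hfinv]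
    · intro k hk
      simp only [map_sub, map_sum, map_smul, hfdiag k _ (show k ≤ n by omega), smul_eq_mul]
      rw [Finset.sum_eq_single (⟨k, by omega⟩ : Fin (n / 2 + 1))]
      · simp
      · intro b _ hb
        rw [if_neg fun h => hb (Fin.ext h.symm), mul_zero]
      · simp
  refine ⟨?_, ?_, ?_⟩
  · rw [Fintype.linearIndependent_iff]
    intro g hg k
    have h := congrArg (diagCoeff K n k) hg
    simpa [hfdiag (k : ℕ) _ (show (k : ℕ) ≤ n by omega), ← Fin.ext_iff] using h
  · ext p
    constructor
    · intro hp
      refine Submodule.span_induction (p := fun p _ => σ p = p ∧ p.totalDegree ≤ 2)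
        ?_ ?_ ?_ ?_ hp
      · rintro _ ⟨k, rfl⟩
        exact ⟨hτ (f k) ▸ hfinv k, hfdeg k⟩
      · simp
      · rintro x y - - ⟨hx, hx'⟩ ⟨hy, hy'⟩
        exact ⟨by rw [map_add, hx, hy],
          (MvPolynomial.totalDegree_add _ _).trans (max_le hx' hy')⟩
      · rintro a x - ⟨hx, hx'⟩
        exact ⟨by rw [map_smul, hx], (MvPolynomial.totalDegree_smul_le _ _).trans hx'⟩
    · rintro ⟨hp, hd⟩
      rw [hexpand p ((hτ p).trans hp) hd]
      exact sum_mem fun k _ => Submodule.smul_mem _ _ (Submodule.subset_span ⟨k, rfl⟩)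
  · intro p hp hd
    refine ⟨diagCoeff K n 0 p, ?_⟩
    conv_lhs => rw [hexpand p ((hτ p).trans hp) (hd.trans one_le_two)]
    rw [Finset.sum_eq_single 0]
    · simp [hf, MvPolynomial.smul_eq_C_mul]
    · intro k _ hk
      have hk0 : (k : ℕ) ≠ 0 := fun h => hk (Fin.ext h)
      have hkn : (k : ℕ) - 1 < n := by omega
      have hz : diagCoeff K n k p = 0 := by
        rw [diagCoeff, MvPolynomial.lcoeff_apply]
        refine MvPolynomial.coeff_eq_zero_of_totalDegree_lt (lt_of_le_of_lt hd ?_)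
        have h2 : 2 ≤ (hexp n k + hexp n k).degree := by
          refine le_trans ?_ (Finsupp.le_degree (⟨(k : ℕ) - 1, hkn⟩ : Fin n) _)
          rw [Finsupp.add_apply, hexp_apply, if_pos (by simp; omega)]
        exact h2
      rw [hz, zero_smul]
    · simp
end
end

section
/- Let τ be the K-algebra automorphism of P_{n+1} = K[x_1,…,x_{n+1}] (n ≥ 2) with τ(x_1) = x_1 and τ(x_i) = x_i + x_{i−1} for 2 ≤ i ≤ n+1, and set m = ⌊n/2⌋ and μ = ⌊(n−1)/2⌋. Then the n elements x_1, p_1, …, p_m, q_1, …, q_μ are τ-invariant and algebraically independent over K; moreover p_k is homogeneous of degree 2 and q_k is homogeneous of degree 3. -/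
noncomputable section

variable (K : Type*) [Field K] [CharZero K]

/-- `p_k = x_{k+1}² + Σ_{i=1}^{k−1} Σ_{j=k}^{2k−i} λ^k_{i,j} x_{i+1}x_{j+1}
  − x_1·Σ_{i=k}^{2k} μ^k_i x_{i+1}` in `K[x_1,…,x_{n+1}]`. -/
def p (n k : ℕ) : MvPolynomial (Fin (n + 1)) K :=
  xv K (n + 1) (k + 1) ^ 2
    + ∑ i ∈ Finset.Icc 1 (k - 1), ∑ j ∈ Finset.Icc k (2 * k - i),
        lam k i j • (xv K (n + 1) (i + 1) * xv K (n + 1) (j + 1))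
    - xv K (n + 1) 1 * ∑ i ∈ Finset.Icc k (2 * k), mu k i • xv K (n + 1) (i + 1)

/-- `q_1 = x_1³ − x_2³ + 3x_1x_2x_3 + x_1²x_2 − 3x_1²x_4`, and for `k ≥ 2`,
`q_k = −x_2·p_k + x_1 x_{k+1}x_{k+2}
  + x_1·Σ_{i=1}^{k−1} Σ_{j=k+1}^{2k−i+1} α^k_{i,j} x_{i+1}x_{j+1}
  − x_1²·Σ_{i=k+1}^{2k+1} β^k_i x_{i+1}`. -/
def q (n k : ℕ) : MvPolynomial (Fin (n + 1)) K :=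
  if k = 1 then
    xv K (n + 1) 1 ^ 3 - xv K (n + 1) 2 ^ 3
      + 3 * xv K (n + 1) 1 * xv K (n + 1) 2 * xv K (n + 1) 3
      + xv K (n + 1) 1 ^ 2 * xv K (n + 1) 2 - 3 * xv K (n + 1) 1 ^ 2 * xv K (n + 1) 4
  else
    -(xv K (n + 1) 2) * p K n k + xv K (n + 1) 1 * xv K (n + 1) (k + 1) * xv K (n + 1) (k + 2)
      + xv K (n + 1) 1 *
          ∑ i ∈ Finset.Icc 1 (k - 1), ∑ j ∈ Finset.Icc (k + 1) (2 * k - i + 1),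
            alph k i j • (xv K (n + 1) (i + 1) * xv K (n + 1) (j + 1))
      - xv K (n + 1) 1 ^ 2 * ∑ i ∈ Finset.Icc (k + 1) (2 * k + 1), bet k i • xv K (n + 1) (i + 1)

namespace InvariantFamily

section Defs

variable {S : Type*} [CommRing S]

/-- The binomial combination `∑ l, C(m,l) x_{j+l}`, given by Pascal's recursion. -/
def binomSum (x : ℕ → S) : ℕ → ℕ → S
  | 0, j => x j
  | m + 1, j => binomSum x m j + binomSum x m (j + 1)

/-- The linear form which is the cofactor of `x_{k-m}` in `quadForm`. -/
def quadCofactor (x : ℕ → S) (k m : ℕ) : S :=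
  binomSum x (m + 1) (k + 1) + binomSum x m (k + 2)

/-- The linear form which is the cofactor of `x_{k-m}` in `liftForm`. -/
def liftCofactor (x : ℕ → S) (k m : ℕ) : S :=
  2 * binomSum x m (k + 2) + 3 * binomSum x m (k + 3)
    + m * (binomSum x (m + 1) (k + 2) + binomSum x m (k + 3))

/-- The quadratic form `p_k`, evaluated at a sequence in a commutative ring. -/
def quadForm (x : ℕ → S) (k : ℕ) : S :=
  x (k + 1) ^ 2 - ∑ m ∈ Finset.range k, (-1) ^ m * (x (k - m) * quadCofactor x k m)

/-- A quadratic form which `τ` translates by `p_k`. -/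
def liftForm (x : ℕ → S) (k : ℕ) : S :=
  x (k + 1) * x (k + 2) - ∑ m ∈ Finset.range k, (-1) ^ m * (x (k - m) * liftCofactor x k m)

/-- The cubic form `q_k`, evaluated at a sequence in a commutative ring. -/
def cubicForm (x : ℕ → S) (k : ℕ) : S :=
  -x 2 * quadForm x k + x 1 * liftForm x k
    + if k = 1 then x 1 ^ 3 - x 1 * quadForm x 1 else 0

lemma binomSum_eq_sum (x : ℕ → S) (m j : ℕ) :
    binomSum x m j = ∑ l ∈ Finset.range (m + 1), (m.choose l : S) * x (j + l) := by
  induction m generalizing j with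
  | zero => simp [binomSum]
  | succ m ih =>
    rw [binomSum, ih, ih, Finset.sum_range_succ' _ (m + 1)]
    simp only [Nat.choose_succ_succ, Nat.cast_add, add_mul, Finset.sum_add_distrib]
    rw [Finset.sum_range_succ' _ m, Finset.sum_range_succ (fun l => (m.choose (l + 1) : S) * _) m]
    simp only [Nat.choose_succ_self, Nat.choose_zero_right, add_assoc, add_comm 1]
    simp
    ring

section Map

variable {T : Type*} [CommRing T] (f : S →+* T) (x : ℕ → S)

lemma map_binomSum (m j : ℕ) : f (binomSum x m j) = binomSum (f ∘ x) m j := by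
  induction m generalizing j with
  | zero => rfl
  | succ m ih => simp [binomSum, ih]

lemma map_quadForm (k : ℕ) : f (quadForm x k) = quadForm (f ∘ x) k := by
  simp [quadForm, quadCofactor, map_binomSum]

lemma map_liftForm (k : ℕ) : f (liftForm x k) = liftForm (f ∘ x) k := by
  simp [liftForm, liftCofactor, map_binomSum, map_ofNat f]

lemma map_cubicForm (k : ℕ) : f (cubicForm x k) = cubicForm (f ∘ x) k := by
  rw [cubicForm, cubicForm]
  split_ifs <;> simp [map_quadForm, map_liftForm]

end Map

section Triangular

variable {x x' : ℕ → S}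

lemma binomSum_sub {m j : ℕ} (h : ∀ i, j ≤ i → i < j + m → x i = x' i) :
    binomSum x m j - binomSum x' m j = x (j + m) - x' (j + m) := by
  induction m generalizing j with
  | zero => rfl
  | succ m ih =>
    have h₁ := ih (j := j) fun i hi hi' => h i hi (by omega)
    have h₂ := ih (j := j + 1) fun i hi hi' => h i (by omega) (by omega)
    rw [h (j + m) (by omega) (by omega)] at h₁
    rw [show j + 1 + m = j + (m + 1) by ring] at h₂
    rw [binomSum, binomSum]
    linear_combination h₁ + h₂

lemma binomSum_congr {m j : ℕ} (h : ∀ i, j ≤ i → i ≤ j + m → x i = x' i) :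
    binomSum x m j = binomSum x' m j := by
  have := binomSum_sub (m := m) (j := j) fun i hi hi' => h i hi hi'.le
  rw [h _ (by omega) le_rfl, sub_self] at this
  exact sub_eq_zero.mp this

lemma quadForm_sub {k : ℕ} (h : ∀ i, 1 ≤ i → i ≤ 2 * (k + 1) → x i = x' i) :
    quadForm x (k + 1) - quadForm x' (k + 1)
      = ((-1) ^ (k + 1) * 2 : ℤ) * x 1 * (x (2 * k + 3) - x' (2 * k + 3)) := by
  have hsum : ∑ m ∈ Finset.range k, (-1) ^ m * (x (k + 1 - m) * quadCofactor x (k + 1) m)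
      = ∑ m ∈ Finset.range k, (-1) ^ m * (x' (k + 1 - m) * quadCofactor x' (k + 1) m) := by
    refine Finset.sum_congr rfl fun m hm => ?_
    rw [Finset.mem_range] at hm
    rw [h (k + 1 - m) (by omega) (by omega), quadCofactor, quadCofactor,
      binomSum_congr (x := x) (x' := x') fun i hi hi' => h i (by omega) (by omega),
      binomSum_congr (x := x) (x' := x') fun i hi hi' => h i (by omega) (by omega)]
  have h₁ : binomSum x (k + 1) (k + 1 + 1) - binomSum x' (k + 1) (k + 1 + 1) = _ :=
    binomSum_sub fun i hi hi' => h i (by omega) (by omega)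
  have h₂ : binomSum x k (k + 1 + 2) - binomSum x' k (k + 1 + 2) = _ :=
    binomSum_sub fun i hi hi' => h i (by omega) (by omega)
  rw [show k + 1 + 1 + (k + 1) = 2 * k + 3 by ring] at h₁
  rw [show k + 1 + 2 + k = 2 * k + 3 by ring] at h₂
  rw [quadForm, quadForm, Finset.sum_range_succ, Finset.sum_range_succ, hsum,
    h (k + 1 + 1) (by omega) (by omega), show k + 1 - k = 1 by omega, ← h 1 le_rfl (by omega),
    quadCofactor, quadCofactor]
  push_cast
  linear_combination (-(-1) ^ k * x 1) * (h₁ + h₂)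

lemma quadForm_congr {k : ℕ} (h : ∀ i, 1 ≤ i → i ≤ 2 * k + 1 → x i = x' i) :
    quadForm x k = quadForm x' k := by
  obtain _ | k := k
  · simp [quadForm, h]
  · have := quadForm_sub (k := k) fun i hi hi' => h i hi (by omega)
    rw [h (2 * k + 3) (by omega) (by omega), sub_self, mul_zero] at this
    exact sub_eq_zero.mp this

lemma liftForm_sub {k : ℕ} (h : ∀ i, 1 ≤ i → i ≤ 2 * k + 3 → x i = x' i) :
    liftForm x (k + 1) - liftForm x' (k + 1)
      = ((-1) ^ (k + 1) * (2 * k + 3) : ℤ) * x 1 * (x (2 * k + 4) - x' (2 * k + 4)) := by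
  have hsum : ∑ m ∈ Finset.range k, (-1) ^ m * (x (k + 1 - m) * liftCofactor x (k + 1) m)
      = ∑ m ∈ Finset.range k, (-1) ^ m * (x' (k + 1 - m) * liftCofactor x' (k + 1) m) := by
    refine Finset.sum_congr rfl fun m hm => ?_
    rw [Finset.mem_range] at hm
    have hb : ∀ a b, 1 ≤ b → a + b ≤ 2 * k + 3 → binomSum x a b = binomSum x' a b :=
      fun a b hb hab => binomSum_congr fun i hi hi' => h i (by omega) (by omega)
    rw [h (k + 1 - m) (by omega) (by omega), liftCofactor, liftCofactor,
      hb _ _ (by omega) (by omega), hb _ _ (by omega) (by omega), hb _ _ (by omega) (by omega)]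
  have h₁ : binomSum x k (k + 1 + 2) = binomSum x' k (k + 1 + 2) :=
    binomSum_congr fun i hi hi' => h i (by omega) (by omega)
  have h₂ : binomSum x (k + 1) (k + 1 + 2) - binomSum x' (k + 1) (k + 1 + 2) = _ :=
    binomSum_sub fun i hi hi' => h i (by omega) (by omega)
  have h₃ : binomSum x k (k + 1 + 3) - binomSum x' k (k + 1 + 3) = _ :=
    binomSum_sub fun i hi hi' => h i (by omega) (by omega)
  rw [show k + 1 + 2 + (k + 1) = 2 * k + 4 by ring] at h₂
  rw [show k + 1 + 3 + k = 2 * k + 4 by ring] at h₃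
  rw [liftForm, liftForm, Finset.sum_range_succ, Finset.sum_range_succ, hsum,
    h (k + 1 + 1) (by omega) (by omega), h (k + 1 + 2) (by omega) (by omega),
    show k + 1 - k = 1 by omega, ← h 1 le_rfl (by omega), liftCofactor, liftCofactor]
  push_cast
  linear_combination (-(-1) ^ k * x 1) * (2 * h₁ + 3 * h₃ + k * (h₂ + h₃))

lemma cubicForm_sub {k : ℕ} (h : ∀ i, 1 ≤ i → i ≤ 2 * k + 3 → x i = x' i) :
    cubicForm x (k + 1) - cubicForm x' (k + 1)
      = ((-1) ^ (k + 1) * (2 * k + 3) : ℤ) * x 1 ^ 2 * (x (2 * k + 4) - x' (2 * k + 4)) := by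
  have hq : ∀ l ≤ k + 1, quadForm x l = quadForm x' l := fun l hl =>
    quadForm_congr fun i hi hi' => h i hi (by omega)
  rw [cubicForm, cubicForm, hq _ le_rfl, hq 1 (by omega), ← h 1 le_rfl (by omega),
    ← h 2 (by omega) (by omega)]
  linear_combination x 1 * liftForm_sub h

lemma cubicForm_congr {k : ℕ} (hk : 1 ≤ k) (h : ∀ i, 1 ≤ i → i ≤ 2 * k + 2 → x i = x' i) :
    cubicForm x k = cubicForm x' k := by
  obtain _ | k := k
  · omega
  · have := cubicForm_sub (k := k) fun i hi hi' => h i hi (by omega)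
    rw [h (2 * k + 4) (by omega) (by omega), sub_self, mul_zero] at this
    exact sub_eq_zero.mp this

end Triangular

section Invariance

variable {τ : S →+* S} {x : ℕ → S} {N : ℕ} (hτ : ∀ i < N, τ (x (i + 1)) = x (i + 1) + x i)
include hτ

lemma map_binomSum_of_shift {m j : ℕ} (h : j + m < N) :
    τ (binomSum x m (j + 1)) = binomSum x (m + 1) j := by
  induction m generalizing j with
  | zero => simp [binomSum, hτ j (by omega), add_comm]
  | succ m ih => rw [binomSum, map_add, ih (by omega), ih (by omega), ← binomSum]

lemma map_quadForm_partial {k M : ℕ} (hM : M ≤ k) (hk : 2 * k < N) :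
    τ (x (k + 1) ^ 2 - ∑ m ∈ Finset.range M, (-1) ^ m * (x (k - m) * quadCofactor x k m))
      = x (k + 1) ^ 2 - ∑ m ∈ Finset.range M, (-1) ^ m * (x (k - m) * quadCofactor x k m)
        + (-1) ^ M * (x (k - M) * (binomSum x (M + 1) k + binomSum x M (k + 1))) := by
  induction M with
  | zero => simp [binomSum, hτ k (by omega)]; ring
  | succ M ih =>
    obtain ⟨r, rfl⟩ : ∃ r, k = r + 1 + M := ⟨k - 1 - M, by omega⟩
    have h := ih (by omega)
    rw [Finset.sum_range_succ, ← sub_sub, map_sub, h]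
    rw [show r + 1 + M - M = r + 1 by omega, show r + 1 + M - (M + 1) = r by omega, map_mul,
      map_mul, hτ r (by omega), quadCofactor, map_add, map_binomSum_of_shift hτ (by omega),
      map_binomSum_of_shift hτ (by omega)]
    simp only [map_pow, map_neg, map_one, binomSum]
    ring

lemma map_quadForm_of_shift (h0 : x 0 = 0) {k : ℕ} (hk : 2 * k < N) :
    τ (quadForm x k) = quadForm x k := by
  rw [quadForm, map_quadForm_partial hτ le_rfl hk]
  simp [h0]

lemma map_liftForm_partial {k M : ℕ} (hM : M ≤ k) (hk : 2 * k + 1 < N) :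
    τ (x (k + 1) * x (k + 2)
        - ∑ m ∈ Finset.range M, (-1) ^ m * (x (k - m) * liftCofactor x k m))
      = x (k + 1) * x (k + 2)
        - ∑ m ∈ Finset.range M, (-1) ^ m * (x (k - m) * liftCofactor x k m)
        + (x (k + 1) ^ 2 - ∑ m ∈ Finset.range M, (-1) ^ m * (x (k - m) * quadCofactor x k m))
        + (-1) ^ M * (x (k - M) * (2 * binomSum x M (k + 1) + 3 * binomSum x M (k + 2)
          + (M - 1) * (binomSum x (M + 1) (k + 1) + binomSum x M (k + 2)))) := by
  induction M with
  | zero => simp [binomSum, hτ k (by omega), hτ (k + 1) (by omega)]; ring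
  | succ M ih =>
    obtain ⟨r, rfl⟩ : ∃ r, k = r + 1 + M := ⟨k - 1 - M, by omega⟩
    have h := ih (by omega)
    rw [Finset.sum_range_succ, ← sub_sub, map_sub, h, Finset.sum_range_succ]
    rw [show r + 1 + M - M = r + 1 by omega, show r + 1 + M - (M + 1) = r by omega, map_mul,
      map_mul, hτ r (by omega), liftCofactor]
    simp only [map_add, map_mul, map_ofNat, map_natCast]
    rw [map_binomSum_of_shift hτ (by omega), map_binomSum_of_shift hτ (by omega),
      map_binomSum_of_shift hτ (by omega)]
    simp only [map_pow, map_neg, map_one, binomSum, quadCofactor]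
    push_cast
    ring

lemma map_liftForm_of_shift (h0 : x 0 = 0) {k : ℕ} (hk : 2 * k + 1 < N) :
    τ (liftForm x k) = liftForm x k + quadForm x k := by
  rw [liftForm, map_liftForm_partial hτ le_rfl hk, quadForm]
  simp [h0]

lemma map_cubicForm_of_shift (h0 : x 0 = 0) {k : ℕ} (hk : 1 ≤ k) (hkN : 2 * k + 1 < N) :
    τ (cubicForm x k) = cubicForm x k := by
  have h1 : τ (x 1) = x 1 := by rw [hτ 0 (by omega), h0, add_zero]
  rw [cubicForm]
  simp only [map_add, map_mul, map_neg, h1, hτ 1 (by omega), map_quadForm_of_shift hτ h0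
    (k := k) (by omega), map_liftForm_of_shift hτ h0 hkN]
  split_ifs with h
  · simp only [map_sub, map_pow, map_mul, h1, map_quadForm_of_shift hτ h0 (k := 1) (by omega)]
    ring
  · rw [map_zero]
    ring

end Invariance

section Coefficients

variable (x : ℕ → S)

lemma sum_Icc_ch {m d a b : ℕ} (ha : a ≤ d) (hb : d + m ≤ b) :
    ∑ j ∈ Finset.Icc a b, ch m ((j : ℤ) - d) • x (j + 1) = binomSum x m (d + 1) := by
  have hsub : Finset.Icc d (d + m) ⊆ Finset.Icc a b := Finset.Icc_subset_Icc ha hb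
  rw [← Finset.sum_subset hsub, binomSum_eq_sum, ← Finset.Ico_add_one_right_eq_Icc,
    Finset.sum_Ico_eq_sum_range]
  · rw [show d + m + 1 - d = m + 1 by omega]
    refine Finset.sum_congr rfl fun l hl => ?_
    rw [Finset.mem_range] at hl
    rw [ch, if_pos (by omega), show ((d + l : ℕ) : ℤ) - d = l by push_cast; ring]
    simp [show d + l + 1 = d + 1 + l by ring]
  · intro j _ hj
    rw [Finset.mem_Icc] at hj
    rw [ch, if_neg (by omega), zero_smul]

lemma sum_Icc_lam {k i m a b : ℕ} (hk : k = i + m + 1) (ha : a ≤ k) (hb : k + m + 1 ≤ b) :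
    ∑ j ∈ Finset.Icc a b, lam k i j • x (j + 1) = (-1) ^ (m + 1) * quadCofactor x k m := by
  have hc : ∀ j : ℕ, lam k i j • x (j + 1) = (-1) ^ (m + 1) *
      (ch (m + 1 : ℕ) ((j : ℤ) - k) • x (j + 1)
        + ch m ((j : ℤ) - (k + 1 : ℕ)) • x (j + 1)) := by
    intro j
    rw [lam, show k - i = m + 1 by omega, show (k : ℤ) - i = (m + 1 : ℕ) by omega,
      show ((m + 1 : ℕ) : ℤ) - 1 = m by omega, show (j : ℤ) - k - 1 = j - (k + 1 : ℕ) by omega]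
    simp only [zsmul_eq_mul]
    push_cast
    ring
  simp only [hc, ← Finset.mul_sum, Finset.sum_add_distrib]
  rw [sum_Icc_ch x ha (by omega), sum_Icc_ch x (by omega) (by omega), quadCofactor]

lemma sum_Icc_mu {m a b : ℕ} (ha : a ≤ m + 1) (hb : 2 * (m + 1) ≤ b) :
    ∑ j ∈ Finset.Icc a b, mu (m + 1) j • x (j + 1) = (-1) ^ m * quadCofactor x (m + 1) m := by
  have hc : ∀ j : ℕ, mu (m + 1) j = -lam (m + 1) 0 j := by
    intro j
    simp [mu, lam, pow_succ]
  simp only [hc, neg_smul, Finset.sum_neg_distrib]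
  rw [sum_Icc_lam x (m := m) (by omega) ha (by omega)]
  ring

lemma sum_Icc_alph {k i m a b : ℕ} (hk : k = i + m + 1) (ha : a ≤ k + 1) (hb : k + m + 2 ≤ b) :
    ∑ j ∈ Finset.Icc a b, alph k i j • x (j + 1) = (-1) ^ (m + 1) * liftCofactor x k m := by
  have hc : ∀ j : ℕ, alph k i j • x (j + 1) = (-1) ^ (m + 1) *
      (2 * (ch m ((j : ℤ) - (k + 1 : ℕ)) • x (j + 1))
        + 3 * (ch m ((j : ℤ) - (k + 2 : ℕ)) • x (j + 1))
        + m * (ch (m + 1 : ℕ) ((j : ℤ) - (k + 1 : ℕ)) • x (j + 1)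
          + ch m ((j : ℤ) - (k + 2 : ℕ)) • x (j + 1))) := by
    intro j
    rw [alph, show k - i = m + 1 by omega, show (k : ℤ) - i = (m + 1 : ℕ) by omega,
      show ((m + 1 : ℕ) : ℤ) - 1 = m by omega, show (j : ℤ) - k - 1 = j - (k + 1 : ℕ) by omega,
      show (j : ℤ) - k - 2 = j - (k + 2 : ℕ) by omega]
    simp only [zsmul_eq_mul]
    push_cast
    ring
  simp only [hc, ← Finset.mul_sum, Finset.sum_add_distrib]
  rw [sum_Icc_ch x ha (by omega), sum_Icc_ch x (by omega) (by omega),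
    sum_Icc_ch x ha (by omega), liftCofactor]

lemma binomSum_succ_index {x y : ℕ → S} (hy : ∀ i, y i = x (i + 1)) (m j : ℕ) :
    binomSum y m j = binomSum x m (j + 1) := by
  induction m generalizing j with
  | zero => exact hy j
  | succ m ih => rw [binomSum, binomSum, ih, ih]

lemma sum_Icc_bet (r : ℕ) :
    ∑ j ∈ Finset.Icc (r + 3) (2 * r + 5), bet (r + 2) j • x (j + 1)
      = (-1) ^ (r + 1) * liftCofactor x (r + 2) (r + 1) := by
  obtain ⟨y, hy⟩ : ∃ y : ℕ → S, ∀ i, y i = x (i + 1) := ⟨_, fun _ => rfl⟩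
  have hshift : ∀ c : ℕ → ℤ, ∑ j ∈ Finset.Icc (r + 3) (2 * r + 5), c (j - 1) • x (j + 1)
      = ∑ j ∈ Finset.Icc (r + 2) (2 * r + 4), c j • y (j + 1) := by
    intro c
    refine Finset.sum_nbij' (fun j => j - 1) (fun j => j + 1) ?_ ?_ ?_ ?_ ?_ <;>
      intro j hj <;> rw [Finset.mem_Icc] at hj
    · exact Finset.mem_Icc.mpr (by omega)
    · exact Finset.mem_Icc.mpr (by omega)
    · exact Nat.sub_add_cancel (by omega)
    · rfl
    · simp only [hy, Nat.sub_add_cancel (show 1 ≤ j by omega)]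
  simp only [bet, add_smul, Finset.sum_add_distrib]
  rw [hshift, hshift, sum_Icc_alph _ (m := r) (by omega) (by omega) (by omega),
    sum_Icc_alph _ (m := r) (by omega) (by omega) (by omega),
    sum_Icc_mu _ (m := r + 1) (by omega) (by omega)]
  simp only [liftCofactor, quadCofactor, binomSum_succ_index hy]
  simp only [binomSum]
  push_cast
  ring

lemma sum_Icc_one_eq_sum_range (f : ℕ → S) (k : ℕ) :
    ∑ i ∈ Finset.Icc 1 k, f i = ∑ m ∈ Finset.range k, f (k - m) := by
  refine Finset.sum_nbij' (fun i => k - i) (fun m => k - m) ?_ ?_ ?_ ?_ ?_ <;>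
    intro i hi <;> simp only [Finset.mem_Icc, Finset.mem_range] at hi ⊢
  any_goals omega
  rw [show k - (k - i) = i by omega]

end Coefficients

section Evaluation

variable (K : Type*) [Field K]

lemma p_eq_quadForm (n : ℕ) {k : ℕ} (hk : 1 ≤ k) : p K n k = quadForm (xv K (n + 1)) k := by
  obtain ⟨k, rfl⟩ : ∃ r, k = r + 1 := ⟨k - 1, by omega⟩
  rw [p, sum_Icc_mu _ le_rfl le_rfl, quadForm, Finset.sum_range_succ, Nat.add_sub_cancel,
    sum_Icc_one_eq_sum_range]
  have hsum : ∀ m ∈ Finset.range k,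
      ∑ j ∈ Finset.Icc (k + 1) (2 * (k + 1) - (k - m)), lam (k + 1) (k - m) j •
          (xv K (n + 1) (k - m + 1) * xv K (n + 1) (j + 1))
        = -((-1) ^ m * (xv K (n + 1) (k + 1 - m) * quadCofactor (xv K (n + 1)) (k + 1) m)) := by
    intro m hm
    rw [Finset.mem_range] at hm
    simp only [← mul_smul_comm, ← Finset.mul_sum]
    rw [sum_Icc_lam _ (m := m) (by omega) le_rfl (by omega), show k - m + 1 = k + 1 - m by omega]
    ring
  rw [Finset.sum_congr rfl hsum, Finset.sum_neg_distrib, show k + 1 - k = 1 by omega]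
  ring

lemma q_eq_cubicForm (n : ℕ) {k : ℕ} (hk : 1 ≤ k) : q K n k = cubicForm (xv K (n + 1)) k := by
  by_cases hk1 : k = 1
  · subst hk1
    simp [q, cubicForm, quadForm, liftForm, quadCofactor, liftCofactor, binomSum]
    ring
  obtain ⟨k, rfl⟩ : ∃ r, k = r + 2 := ⟨k - 2, by omega⟩
  rw [q, if_neg hk1, cubicForm, if_neg hk1, p_eq_quadForm K n hk,
    show k + 2 + 1 = k + 3 by ring, show 2 * (k + 2) + 1 = 2 * k + 5 by ring, sum_Icc_bet,
    liftForm, Finset.sum_range_succ, show k + 2 - 1 = k + 1 by omega, sum_Icc_one_eq_sum_range]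
  have hsum : ∀ m ∈ Finset.range (k + 1),
      ∑ j ∈ Finset.Icc (k + 3) (2 * (k + 2) - (k + 1 - m) + 1), alph (k + 2) (k + 1 - m) j •
          (xv K (n + 1) (k + 1 - m + 1) * xv K (n + 1) (j + 1))
        = -((-1) ^ m * (xv K (n + 1) (k + 2 - m) * liftCofactor (xv K (n + 1)) (k + 2) m)) := by
    intro m hm
    rw [Finset.mem_range] at hm
    simp only [← mul_smul_comm, ← Finset.mul_sum]
    rw [sum_Icc_alph _ (m := m) (by omega) le_rfl (by omega),
      show k + 1 - m + 1 = k + 2 - m by omega]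
    ring
  rw [Finset.sum_congr rfl hsum, Finset.sum_neg_distrib, show k + 2 - (k + 1) = 1 by omega]
  ring

open MvPolynomial

lemma isHomogeneous_xv (n k : ℕ) : (xv K n k).IsHomogeneous 1 := by
  rw [xv]
  split_ifs
  · exact isHomogeneous_X _ _
  · exact isHomogeneous_zero _ _ _

lemma isHomogeneous_zsmul {σ R : Type*} [CommRing R] {f : MvPolynomial σ R} {d : ℕ}
    (hf : f.IsHomogeneous d) (c : ℤ) : (c • f).IsHomogeneous d := by
  rw [← mem_homogeneousSubmodule] at hf ⊢
  exact zsmul_mem hf c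

lemma isHomogeneous_p (n k : ℕ) : (p K n k).IsHomogeneous 2 := by
  have hx := isHomogeneous_xv K (n + 1)
  refine ((hx _).pow 2 |>.add ?_).sub ?_
  · exact IsHomogeneous.sum _ _ _ fun i _ => IsHomogeneous.sum _ _ _ fun j _ =>
      isHomogeneous_zsmul ((hx _).mul (hx _)) _
  · exact (hx _).mul (IsHomogeneous.sum _ _ _ fun i _ => isHomogeneous_zsmul (hx _) _)

lemma isHomogeneous_q (n k : ℕ) : (q K n k).IsHomogeneous 3 := by
  have hx := isHomogeneous_xv K (n + 1)
  have h3 : (3 : MvPolynomial (Fin (n + 1)) K).IsHomogeneous 0 := isHomogeneous_C _ 3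
  rw [q]
  split_ifs
  · exact ((((hx _).pow 3).sub ((hx _).pow 3)).add (((h3.mul (hx _)).mul (hx _)).mul (hx _))
      |>.add (((hx _).pow 2).mul (hx _))).sub ((h3.mul ((hx _).pow 2)).mul (hx _))
  · refine IsHomogeneous.sub (IsHomogeneous.add (IsHomogeneous.add ?_ ?_) ?_) ?_
    · exact (hx 2).neg.mul (isHomogeneous_p K n k)
    · exact ((hx _).mul (hx _)).mul (hx _)
    · exact (hx _).mul (IsHomogeneous.sum _ _ 2 fun i _ => IsHomogeneous.sum _ _ _ fun j _ =>
        isHomogeneous_zsmul ((hx _).mul (hx _)) _)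
    · exact ((hx _).pow 2).mul (IsHomogeneous.sum _ _ 1 fun i _ => isHomogeneous_zsmul (hx _) _)

end Evaluation

end Defs

/-- The forms are triangular in the variables, hence can be given arbitrary values. -/
lemma exists_forms_eq {F : Type*} [Field F] [CharZero F] (t : ℕ → F) (ht : t 1 ≠ 0) (N : ℕ) :
    ∃ v : ℕ → F, v 1 = t 1
      ∧ (∀ k, 1 ≤ k → 2 * k + 1 ≤ N → quadForm v k = t (2 * k + 1))
      ∧ (∀ k, 1 ≤ k → 2 * k + 2 ≤ N → cubicForm v k = t (2 * k + 2)) := by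
  induction N with
  | zero => exact ⟨t, rfl, fun k hk hk' => by omega, fun k hk hk' => by omega⟩
  | succ N ih =>
    obtain ⟨v, hv1, hvp, hvq⟩ := ih
    rcases lt_or_ge N 2 with hN | hN
    · exact ⟨v, hv1, fun k hk hk' => by omega, fun k hk hk' => by omega⟩
    have hupd : ∀ z i, i ≠ N + 1 → Function.update v (N + 1) z i = v i := fun z i hi =>
      Function.update_of_ne hi _ _
    obtain ⟨z, hz⟩ : ∃ z,
        (∀ k, 1 ≤ k → 2 * k = N → quadForm (Function.update v (N + 1) z) k = t (N + 1))
        ∧ (∀ k, 1 ≤ k → 2 * k + 1 = N →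
          cubicForm (Function.update v (N + 1) z) k = t (N + 1)) := by
      obtain ⟨k, hk | hk⟩ : ∃ k, N = 2 * (k + 1) ∨ N = 2 * (k + 1) + 1 :=
        ⟨N / 2 - 1, by omega⟩
      · subst hk
        refine ⟨v (2 * k + 3) + (t (2 * k + 3) - quadForm v (k + 1))
          / (((-1) ^ (k + 1) * 2 : ℤ) * v 1), fun l hl hlk => ?_, fun l hl hlk => by omega⟩
        obtain rfl : l = k + 1 := by omega
        have hc : (((-1) ^ (k + 1) * 2 : ℤ) : F) * v 1 ≠ 0 :=
          mul_ne_zero (Int.cast_ne_zero.mpr (by simp)) (hv1 ▸ ht)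
        have := quadForm_sub (x := v) (x' := Function.update v (2 * (k + 1) + 1) (v (2 * k + 3)
          + (t (2 * k + 3) - quadForm v (k + 1)) / (((-1) ^ (k + 1) * 2 : ℤ) * v 1))) (k := k)
          fun i hi hi' => (hupd _ i (by omega)).symm
        rw [show 2 * (k + 1) + 1 = 2 * k + 3 by ring] at this ⊢
        rw [Function.update_self, sub_add_cancel_left, mul_neg, mul_div_cancel₀ _ hc] at this
        linear_combination -this
      · subst hk
        refine ⟨v (2 * k + 4) + (t (2 * k + 4) - cubicForm v (k + 1))
          / (((-1) ^ (k + 1) * (2 * k + 3) : ℤ) * v 1 ^ 2), fun l hl hlk => by omega,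
          fun l hl hlk => ?_⟩
        obtain rfl : l = k + 1 := by omega
        have hc : (((-1) ^ (k + 1) * (2 * k + 3) : ℤ) : F) * v 1 ^ 2 ≠ 0 :=
          mul_ne_zero (Int.cast_ne_zero.mpr (mul_ne_zero (by simp) (by omega)))
            (pow_ne_zero _ (hv1 ▸ ht))
        have := cubicForm_sub (x := v) (x' := Function.update v (2 * (k + 1) + 1 + 1)
          (v (2 * k + 4) + (t (2 * k + 4) - cubicForm v (k + 1))
            / (((-1) ^ (k + 1) * (2 * k + 3) : ℤ) * v 1 ^ 2))) (k := k)
          fun i hi hi' => (hupd _ i (by omega)).symm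
        rw [show 2 * (k + 1) + 1 + 1 = 2 * k + 4 by ring] at this ⊢
        rw [Function.update_self, sub_add_cancel_left, mul_neg, mul_div_cancel₀ _ hc] at this
        linear_combination -this
    refine ⟨Function.update v (N + 1) z, by rw [hupd _ _ (by omega), hv1], ?_, ?_⟩
    · intro k hk hkN
      rcases hkN.lt_or_eq with h | h
      · rw [← hvp k hk (by omega)]
        exact quadForm_congr fun i hi hi' => hupd _ _ (by omega)
      · rw [hz.1 k hk (by omega), h]
    · intro k hk hkN
      rcases hkN.lt_or_eq with h | h
      · rw [← hvq k hk (by omega)]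
        exact cubicForm_congr hk fun i hi hi' => hupd _ _ (by omega)
      · rw [hz.2 k hk (by omega), h]

lemma algebraicIndependent_forms (K : Type*) [Field K] [CharZero K] (n : ℕ) :
    AlgebraicIndependent K
      (fun i : Option (Fin (n / 2) ⊕ Fin ((n - 1) / 2)) =>
        i.elim (xv K (n + 1) 1)
          (Sum.elim (fun a : Fin (n / 2) => p K n ((a : ℕ) + 1))
            (fun b : Fin ((n - 1) / 2) => q K n ((b : ℕ) + 1)))) := by
  let F := FractionRing (MvPolynomial ℕ K)
  have : CharZero F := charZero_of_injective_algebraMap (algebraMap K F).injective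
  let ι : MvPolynomial ℕ K →ₐ[K] F := IsScalarTower.toAlgHom K (MvPolynomial ℕ K) F
  have hι : Function.Injective ι := IsFractionRing.injective (MvPolynomial ℕ K) F
  let t : ℕ → F := ι ∘ MvPolynomial.X
  have ht : AlgebraicIndependent K t := (MvPolynomial.algebraicIndependent_X ℕ K).map' hι
  obtain ⟨v, hv1, hvp, hvq⟩ := exists_forms_eq t (ht.ne_zero 1) (n + 1)
  let φ : MvPolynomial (Fin (n + 1)) K →ₐ[K] F := MvPolynomial.aeval fun i => v (i + 1)
  have hφ : ∀ i, 1 ≤ i → i ≤ n + 1 → φ (xv K (n + 1) i) = v i := by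
    intro i hi hin
    rw [xv, dif_pos (by omega), MvPolynomial.aeval_X]
    exact congrArg v (Nat.sub_add_cancel hi)
  let d : Option (Fin (n / 2) ⊕ Fin ((n - 1) / 2)) → ℕ := fun i =>
    i.elim 1 (Sum.elim (fun a => 2 * ((a : ℕ) + 1) + 1) (fun b => 2 * ((b : ℕ) + 1) + 2))
  have hd : Function.Injective d := by
    rintro (_ | a | a) (_ | b | b) h <;> simp only [d, Option.elim, Sum.elim_inl, Sum.elim_inr] at h
    all_goals first
      | rfl
      | omega
      | (obtain rfl : a = b := Fin.ext (by omega)); rfl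
  refine AlgebraicIndependent.of_comp φ ?_
  convert ht.comp d hd using 1
  funext i
  rcases i with _ | a | b
  · exact (hφ 1 le_rfl (by omega)).trans hv1
  · have ha := a.isLt
    change (φ : _ →+* F) (p K n (a + 1)) = t (2 * ((a : ℕ) + 1) + 1)
    rw [← hvp (a + 1) (by omega) (by omega), p_eq_quadForm K n (by omega), map_quadForm]
    exact quadForm_congr fun i hi hi' => hφ i hi (by omega)
  · have hb := b.isLt
    change (φ : _ →+* F) (q K n (b + 1)) = t (2 * ((b : ℕ) + 1) + 2)
    rw [← hvq (b + 1) (by omega) (by omega), q_eq_cubicForm K n (by omega), map_cubicForm]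
    exact cubicForm_congr (by omega) fun i hi hi' => hφ i hi (by omega)

end InvariantFamily

/-- The elements `x_1, p_1, …, p_m, q_1, …, q_μ` are `τ`-invariant and algebraically
independent; `p_k` is homogeneous of degree 2 and `q_k` of degree 3. -/
theorem transcendence_basis_p_q {K : Type*} [Field K] [CharZero K] {n : ℕ} (hn : 2 ≤ n)
    (τ : MvPolynomial (Fin (n + 1)) K ≃ₐ[K] MvPolynomial (Fin (n + 1)) K)
    (hτ1 : τ (xv K (n + 1) 1) = xv K (n + 1) 1)
    (hτ : ∀ k, 2 ≤ k → k ≤ n + 1 → τ (xv K (n + 1) k) = xv K (n + 1) k + xv K (n + 1) (k - 1)) :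
    (∀ k, 1 ≤ k → k ≤ n / 2 → τ (p K n k) = p K n k)
    ∧ (∀ k, 1 ≤ k → k ≤ (n - 1) / 2 → τ (q K n k) = q K n k)
    ∧ AlgebraicIndependent K
        (fun i : Option (Fin (n / 2) ⊕ Fin ((n - 1) / 2)) =>
          i.elim (xv K (n + 1) 1)
            (Sum.elim (fun a : Fin (n / 2) => p K n ((a : ℕ) + 1))
              (fun b : Fin ((n - 1) / 2) => q K n ((b : ℕ) + 1))))
    ∧ (∀ k, 1 ≤ k → k ≤ n / 2 → (p K n k).IsHomogeneous 2)
    ∧ (∀ k, 1 ≤ k → k ≤ (n - 1) / 2 → (q K n k).IsHomogeneous 3) := by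
  have hinv : ∀ i < n + 1, τ (Function.update (xv K (n + 1)) 0 0 (i + 1))
      = Function.update (xv K (n + 1)) 0 0 (i + 1) + Function.update (xv K (n + 1)) 0 0 i := by
    intro i hi
    obtain _ | i := i
    · simpa using hτ1
    · simpa using hτ (i + 2) (by omega) (by omega)
  have h0 : Function.update (xv K (n + 1)) 0 0 0 = 0 := Function.update_self _ _ _
  have hagree : ∀ i, 1 ≤ i → Function.update (xv K (n + 1)) 0 0 i = xv K (n + 1) i :=
    fun i hi => Function.update_of_ne (by omega) _ _
  refine ⟨fun k hk hkn => ?_, fun k hk hkn => ?_, InvariantFamily.algebraicIndependent_forms K n,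
    fun k _ _ => InvariantFamily.isHomogeneous_p K n k,
    fun k _ _ => InvariantFamily.isHomogeneous_q K n k⟩
  · rw [InvariantFamily.p_eq_quadForm K n hk,
      ← InvariantFamily.quadForm_congr fun i hi _ => hagree i hi]
    exact InvariantFamily.map_quadForm_of_shift (τ := (τ : _ →+* _)) (N := n + 1) (k := k)
      hinv h0 (by omega)
  · rw [InvariantFamily.q_eq_cubicForm K n hk,
      ← InvariantFamily.cubicForm_congr hk fun i hi _ => hagree i hi]
    exact InvariantFamily.map_cubicForm_of_shift (τ := (τ : _ →+* _)) (N := n + 1) (k := k)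
      hinv h0 hk (by omega)
end
end
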